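/- arXiv:2007.12548 — 6 statements merged into one kernel-verified Lean document; each statement's English description precedes it below -/
import Mathlib

section
/- Let q : B^p → ℝ be radially symmetric with trace q̄ : [0,a₀) → ℝ, i.e. q(x) = q̄(|x|). Then for any integer n ≥ 0 the following are equivalent: (i) q is C^n on B^p; (ii) q̄ is C^n on [0,a₀) (up to the boundary point 0) and all derivatives of q̄ of odd order ≤ n vanish at 0; (iii) q̄(r) = P(r²) + Φ(r), where P is a polynomial of degree at most ⌊n/2⌋ and Φ is C^n on [0,a₀) with Φ(r) = o(r^n) as r → 0⁺. -/
open Set Filter Topology Asymptotics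
open scoped ContDiff

/-- Bound for a function smooth off the origin and homogeneous of degree `-j`. -/
lemma homog_bound {E F : Type} [NormedAddCommGroup E] [InnerProductSpace ℝ E]
    [FiniteDimensional ℝ E] [NormedAddCommGroup F] [NormedSpace ℝ F]
    (j : ℕ) (M : E → F) (hM : ∀ x, x ≠ 0 → ContDiffAt ℝ ∞ M x)
    (hhom : ∀ t : ℝ, 0 < t → ∀ x, x ≠ 0 → M (t • x) = (t ^ j)⁻¹ • M x) :
    ∃ C : ℝ, 0 < C ∧ ∀ x, x ≠ 0 → ‖M x‖ ≤ C * (‖x‖ ^ j)⁻¹ := by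
  have hc : IsCompact (Metric.sphere (0 : E) 1) := isCompact_sphere _ _
  have hcont : ContinuousOn M (Metric.sphere (0 : E) 1) := fun x hx =>
    (hM x (by
      rintro rfl
      simp at hx)).continuousAt.continuousWithinAt
  obtain ⟨C, hC⟩ := hc.exists_bound_of_continuousOn hcont
  refine ⟨max C 1, by positivity, fun x hx => ?_⟩
  have hn : 0 < ‖x‖ := norm_pos_iff.2 hx
  have hu : ‖x‖⁻¹ • x ≠ 0 := smul_ne_zero (by positivity) hx
  have h1 := hhom ‖x‖ hn (‖x‖⁻¹ • x) hu
  rw [smul_inv_smul₀ hn.ne'] at h1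
  rw [h1, norm_smul, mul_comm, Real.norm_of_nonneg (by positivity)]
  gcongr
  refine (hC _ ?_).trans (le_max_left _ _)
  simp [norm_smul, hn.ne']

lemma radial_contDiffOn {E : Type} [NormedAddCommGroup E] [InnerProductSpace ℝ E]
    [FiniteDimensional ℝ E] (a : ℝ) (ha : 0 < a) (N : ℕ) (Φ : ℕ → ℝ → ℝ)
    (hc : ∀ i ≤ N, ContinuousOn (Φ i) (Ioo 0 a))
    (hd : ∀ i < N, ∀ r ∈ Ioo 0 a, HasDerivAt (Φ i) (Φ (i + 1) r) r)
    (h0 : ∀ i ≤ N, Φ i 0 = 0)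
    (ho : ∀ i m : ℕ, i + m ≤ N → Φ i =o[𝓝[Ico 0 a] 0] fun r => r ^ m)
    (n : ℕ) : ∀ (F : Type) [NormedAddCommGroup F] [NormedSpace ℝ F]
    (i j : ℕ) (_ : i + j + n ≤ N)
    (M : E → F) (_ : ∀ x, x ≠ 0 → ContDiffAt ℝ ∞ M x)
    (_ : ∀ t : ℝ, 0 < t → ∀ x, x ≠ 0 → M (t • x) = (t ^ j)⁻¹ • M x),
    ContDiffOn ℝ n (fun x => Φ i ‖x‖ • M x) (Metric.ball (0 : E) a) := by
  have htend : Tendsto (fun x : E => ‖x‖) (𝓝 0) (𝓝[Ico 0 a] 0) := by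
    rw [tendsto_nhdsWithin_iff]
    refine ⟨by simpa using (continuous_norm (E := E)).tendsto 0, ?_⟩
    filter_upwards [Metric.ball_mem_nhds (0 : E) ha] with x hx
    exact ⟨norm_nonneg _, by simpa using hx⟩
  have hlit : ∀ (F : Type) [NormedAddCommGroup F] [NormedSpace ℝ F]
      (i j m : ℕ) (_ : i + j + m ≤ N)
      (M : E → F) (_ : ∀ x, x ≠ 0 → ContDiffAt ℝ ∞ M x)
      (_ : ∀ t : ℝ, 0 < t → ∀ x, x ≠ 0 → M (t • x) = (t ^ j)⁻¹ • M x),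
      (fun x => Φ i ‖x‖ • M x) =o[𝓝 0] fun x => ‖x‖ ^ m := by
    intro F _ _ i j m him M hM hhom
    obtain ⟨C, hC, hb⟩ := homog_bound j M hM hhom
    have h1 := (ho i (m + j) (by omega)).comp_tendsto htend
    rw [isLittleO_iff] at h1 ⊢
    intro c hcpos
    filter_upwards [h1 (c := c / C) (by positivity)] with x hx
    by_cases hx0 : x = 0
    · subst hx0
      simp only [norm_zero, h0 i (by omega), zero_smul]
      positivity
    have hn : 0 < ‖x‖ := norm_pos_iff.2 hx0
    simp only [Function.comp] at hx
    rw [norm_smul]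
    calc ‖Φ i ‖x‖‖ * ‖M x‖ ≤ (c / C * ‖‖x‖ ^ (m + j)‖) * (C * (‖x‖ ^ j)⁻¹) := by
          gcongr
          exact hb x hx0
      _ = c * ‖‖x‖ ^ m‖ := by
          rw [Real.norm_of_nonneg (by positivity), Real.norm_of_nonneg (by positivity), pow_add]
          field_simp
  induction n with
  | zero =>
    intro F _ _ i j hij M hM hhom
    simp only [Nat.cast_zero, contDiffOn_zero]
    intro x hx
    apply ContinuousAt.continuousWithinAt
    by_cases hx0 : x = 0
    · subst hx0
      have := hlit F i j 0 hij M hM hhom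
      simp only [pow_zero, isLittleO_one_iff] at this
      rw [ContinuousAt]
      simpa [h0 i (by omega)] using this
    · have hxm : ‖x‖ ∈ Ioo 0 a := ⟨norm_pos_iff.2 hx0, by simpa using hx⟩
      have h1 : ContinuousAt (Φ i) ‖x‖ :=
        (hc i (by omega)).continuousAt (Ioo_mem_nhds hxm.1 hxm.2)
      have h2 : ContinuousAt (fun y : E => Φ i ‖y‖) x :=
        ContinuousAt.comp (f := fun y : E => ‖y‖) h1 continuous_norm.continuousAt
      exact h2.smul (hM x hx0).continuousAt
  | succ n ih =>
    intro F _ _ i j hij M hM hhom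
    let M1 : E → (E →L[ℝ] F) := fun x => (fderiv ℝ (fun y : E => ‖y‖) x).smulRight (M x)
    let M2 : E → (E →L[ℝ] F) := fun x => fderiv ℝ M x
    have hM1 : ∀ x, x ≠ 0 → ContDiffAt ℝ ∞ M1 x := by
      intro x hx
      refine ContDiffAt.smulRight ?_ (hM x hx)
      exact (contDiffAt_norm (n := ∞) ℝ hx).fderiv_right (by simp)
    have hM2 : ∀ x, x ≠ 0 → ContDiffAt ℝ ∞ M2 x := by
      intro x hx
      exact (hM x hx).fderiv_right (by simp)
    have hh1 : ∀ t : ℝ, 0 < t → ∀ x, x ≠ 0 → M1 (t • x) = (t ^ j)⁻¹ • M1 x := by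
      intro t ht x hx
      ext v
      simp only [M1, fderiv_norm_smul_pos ht, hhom t ht x hx, ContinuousLinearMap.smulRight_apply,
        smul_apply]
      rw [smul_comm]
    have hh2 : ∀ t : ℝ, 0 < t → ∀ x, x ≠ 0 → M2 (t • x) = (t ^ (j + 1))⁻¹ • M2 x := by
      intro t ht x hx
      have e1 : fderiv ℝ (fun y => M (t • y)) x = t • fderiv ℝ M (t • x) :=
        fderiv_comp_smul t
      have e2 : (fun y => M (t • y)) =ᶠ[𝓝 x] fun y => (t ^ j)⁻¹ • M y := by
        filter_upwards [isOpen_ne.mem_nhds hx] with y hy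
        exact hhom t ht y hy
      rw [e2.fderiv_eq, fderiv_fun_const_smul ((hM x hx).differentiableAt (by simp))] at e1
      simp only [M2]
      rw [pow_succ, mul_inv_rev, mul_smul, e1, inv_smul_smul₀ ht.ne']
    have hder : ∀ x ∈ Metric.ball (0 : E) a, HasFDerivAt (fun x => Φ i ‖x‖ • M x)
        (Φ (i + 1) ‖x‖ • M1 x + Φ i ‖x‖ • M2 x) x := by
      intro x hx
      by_cases hx0 : x = 0
      · subst hx0
        have h1 := hlit F i j 1 (by omega) M hM hhom
        rw [hasFDerivAt_iff_isLittleO_nhds_zero]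
        simp only [pow_one] at h1
        simpa [h0 i (by omega), h0 (i + 1) (by omega)] using isLittleO_norm_right.1 h1
      · have hxm : ‖x‖ ∈ Ioo 0 a := ⟨norm_pos_iff.2 hx0, by simpa using hx⟩
        have hnorm : HasFDerivAt (fun y : E => ‖y‖) (fderiv ℝ (fun y : E => ‖y‖) x) x :=
          ((contDiffAt_norm (n := ∞) ℝ hx0).differentiableAt (by simp)).hasFDerivAt
        have h1 := (hd i (by omega) _ hxm).comp_hasFDerivAt x hnorm
        have h2 := h1.smul ((hM x hx0).differentiableAt (by simp)).hasFDerivAt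
        refine h2.congr_fderiv ?_
        ext v
        simp [M1, M2, mul_smul, add_comm]
    have hopen : IsOpen (Metric.ball (0 : E) a) := Metric.isOpen_ball
    have := (contDiffOn_succ_iff_fderiv_of_isOpen (𝕜 := ℝ) (n := n)
      (f := fun x => Φ i ‖x‖ • M x) hopen).2 ⟨fun x hx =>
        (hder x hx).differentiableAt.differentiableWithinAt, by simp, ?_⟩
    · exact_mod_cast this
    · refine ContDiffOn.congr ((ih _ (i + 1) j (by omega) M1 hM1 hh1).add
        (ih _ i (j + 1) (by omega) M2 hM2 hh2)) ?_
      intro x hx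
      exact (hder x hx).fderiv

lemma iteratedDerivWithin_iter (f : ℝ → ℝ) (s : Set ℝ) (i k : ℕ) :
    iteratedDerivWithin k (iteratedDerivWithin i f s) s = iteratedDerivWithin (i + k) f s := by
  induction k with
  | zero => simp
  | succ k ih => rw [iteratedDerivWithin_succ, ih, ← add_assoc, iteratedDerivWithin_succ]

lemma contDiffOn_iter (f : ℝ → ℝ) (s : Set ℝ) (hs : UniqueDiffOn ℝ s) (n i m : ℕ) (h : i + m ≤ n)
    (hf : ContDiffOn ℝ n f s) : ContDiffOn ℝ m (iteratedDerivWithin i f s) s := by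
  rw [contDiffOn_nat_iff_continuousOn_differentiableOn_deriv hs] at hf ⊢
  simp only [iteratedDerivWithin_iter]
  exact ⟨fun k hk => hf.1 _ (by omega), fun k hk => hf.2 _ (by omega)⟩

lemma nhdsGT_le (a : ℝ) (ha : 0 < a) : 𝓝[>] (0 : ℝ) ≤ 𝓝[Ico 0 a] 0 := by
  rw [← nhdsWithin_Ioo_eq_nhdsGT ha]
  exact nhdsWithin_mono _ Ioo_subset_Ico_self

/-- If `Φ = o(r^n)` then all derivatives of order at most `n` vanish. -/
lemma deriv_vanish (a : ℝ) (ha : 0 < a) (n : ℕ) (Φ : ℝ → ℝ) (hΦ : ContDiffOn ℝ n Φ (Ico 0 a))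
    (ho : Φ =o[𝓝[>] 0] fun r => r ^ n) (k : ℕ) (hk : k ≤ n) :
    iteratedDerivWithin k Φ (Ico 0 a) 0 = 0 := by
  induction k using Nat.strong_induction_on with
  | _ k ih =>
  have h1 := taylor_isLittleO (convex_Ico 0 a) (⟨le_rfl, ha⟩ : (0 : ℝ) ∈ Ico 0 a)
    (hΦ.of_le (by exact_mod_cast hk : (k : WithTop ℕ∞) ≤ n))
  have h2 := h1.mono (nhdsGT_le a ha)
  have hT : ∀ r, taylorWithinEval Φ k (Ico 0 a) 0 r =
      (iteratedDerivWithin k Φ (Ico 0 a) 0 / k.factorial) * r ^ k := by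
    intro r
    rw [taylor_within_apply, Finset.sum_range_succ, Finset.sum_eq_zero]
    · simp; ring
    · intro l hl
      have := Finset.mem_range.1 hl
      rw [ih l this (by omega), smul_zero]
  simp only [hT, sub_zero] at h2
  have h3 : (fun r : ℝ => r ^ n) =O[𝓝[>] 0] fun r => r ^ k := by
    rcases hk.eq_or_lt with rfl | hlt
    · exact isBigO_refl _ _
    · exact (isLittleO_pow_pow hlt).isBigO.mono nhdsWithin_le_nhds
  · have h4 := (ho.trans_isBigO h3).sub h2
    simp only [sub_sub_cancel] at h4
    have h5 := (isLittleO_iff_tendsto' (by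
      filter_upwards [self_mem_nhdsWithin] with r hr h
      exact absurd h (pow_ne_zero _ (ne_of_gt hr)))).1 h4
    have h6 : Tendsto (fun _ : ℝ => iteratedDerivWithin k Φ (Ico 0 a) 0 / k.factorial)
        (𝓝[>] 0) (𝓝 0) := by
      refine h5.congr' ?_
      filter_upwards [self_mem_nhdsWithin] with r hr
      rw [mul_div_assoc, div_self (pow_ne_zero _ (ne_of_gt hr)), mul_one]
    have h7 := tendsto_nhds_unique h6 tendsto_const_nhds
    have : (k.factorial : ℝ) ≠ 0 := by positivity
    exact (div_eq_zero_iff.1 h7.symm).resolve_right this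

lemma iii_to_i {E : Type} [NormedAddCommGroup E] [InnerProductSpace ℝ E]
    [FiniteDimensional ℝ E] (a : ℝ) (ha : 0 < a) (n : ℕ) (Φ : ℝ → ℝ)
    (hΦ : ContDiffOn ℝ n Φ (Ico 0 a)) (ho : Φ =o[𝓝[>] 0] fun r => r ^ n) :
    ContDiffOn ℝ n (fun x : E => Φ ‖x‖) (Metric.ball 0 a) := by
  have hs : UniqueDiffOn ℝ (Ico 0 a) := uniqueDiffOn_Ico 0 a
  have hv := deriv_vanish a ha n Φ hΦ ho
  have h := radial_contDiffOn (E := E) a ha n (fun i => iteratedDerivWithin i Φ (Ico 0 a))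
    (fun i hi => (hΦ.continuousOn_iteratedDerivWithin (by exact_mod_cast hi) hs).mono
      Ioo_subset_Ico_self) ?_ hv ?_ n ℝ 0 0 (by omega) (fun _ => 1)
      (fun _ _ => contDiffAt_const) (by simp)
  · simpa using h
  · intro i hi r hr
    have h1 := (hΦ.differentiableOn_iteratedDerivWithin (m := i) (by exact_mod_cast hi) hs) r
      (Ioo_subset_Ico_self hr)
    have h2 := h1.hasDerivWithinAt
    rw [← iteratedDerivWithin_succ] at h2
    exact h2.hasDerivAt (Ico_mem_nhds hr.1 hr.2)
  · intro i m him
    have h1 := taylor_isLittleO (convex_Ico 0 a) (⟨le_rfl, ha⟩ : (0 : ℝ) ∈ Ico 0 a)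
      (contDiffOn_iter Φ _ hs n i m him hΦ)
    refine (h1.congr_left ?_).congr_right (by simp)
    intro r
    rw [taylor_within_apply, Finset.sum_eq_zero, sub_zero]
    intro l hl
    have := Finset.mem_range.1 hl
    rw [iteratedDerivWithin_iter, hv _ (by omega), smul_zero]

lemma poly_contDiff (P : Polynomial ℝ) (n : ℕ) : ContDiff ℝ n (fun x : ℝ => P.eval x) := by
  simpa using P.contDiff_aeval (𝕜 := ℝ) (R := ℝ) n

lemma ii_to_iii (a : ℝ) (ha : 0 < a) (n : ℕ) (f : ℝ → ℝ) (hf : ContDiffOn ℝ n f (Ico 0 a))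
    (hodd : ∀ k : ℕ, Odd k → k ≤ n → iteratedDerivWithin k f (Ico 0 a) 0 = 0) :
    ∃ (P : Polynomial ℝ) (Φ : ℝ → ℝ),
        P.natDegree ≤ n / 2 ∧
        ContDiffOn ℝ n Φ (Set.Ico 0 a) ∧
        Filter.Tendsto (fun r => Φ r / r ^ n) (nhdsWithin 0 (Set.Ioi 0)) (nhds 0) ∧
        ∀ r ∈ Set.Ico 0 a, f r = P.eval (r ^ 2) + Φ r := by
  let c : ℕ → ℝ := fun k => iteratedDerivWithin k f (Ico 0 a) 0 / k.factorial
  let P : Polynomial ℝ := ∑ k ∈ Finset.range (n / 2 + 1), Polynomial.monomial k (c (2 * k))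
  have hP : ∀ r, P.eval (r ^ 2) = taylorWithinEval f n (Ico 0 a) 0 r := by
    intro r
    rw [taylor_within_apply, Polynomial.eval_finsetSum]
    have e : ∀ k ∈ Finset.range (n + 1), ((k.factorial : ℝ)⁻¹ * (r - 0) ^ k) •
        iteratedDerivWithin k f (Ico 0 a) 0 = c k * r ^ k := by
      intro k _
      simp [c]; ring
    rw [Finset.sum_congr rfl e]
    symm
    have hinj : Set.InjOn (fun k : ℕ => 2 * k) (Finset.range (n / 2 + 1)) :=
      fun x _ y _ h => by simpa using h
    rw [← Finset.sum_subset (s₁ := (Finset.range (n / 2 + 1)).image (fun k => 2 * k))]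
    · rw [Finset.sum_image hinj]
      refine Finset.sum_congr rfl fun k _ => ?_
      rw [Polynomial.eval_monomial, pow_mul]
    · intro k hk
      simp only [Finset.mem_image, Finset.mem_range] at hk ⊢
      omega
    · intro k hk hk'
      simp only [Finset.mem_image, Finset.mem_range, not_exists, not_and] at hk hk'
      have : Odd k := by
        rw [← Nat.not_even_iff_odd]
        rintro ⟨l, rfl⟩
        exact hk' l (by omega) (by omega)
      simp [c, hodd k this (by omega)]
  refine ⟨P, fun r => f r - P.eval (r ^ 2), ?_, ?_, ?_, ?_⟩
  · refine Polynomial.natDegree_sum_le_of_forall_le _ _ fun k hk => ?_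
    have := Finset.mem_range.1 hk
    exact (Polynomial.natDegree_monomial_le _).trans (by omega)
  · refine hf.sub (ContDiff.contDiffOn ?_)
    exact (poly_contDiff P n).comp (contDiff_id.pow 2)
  · have h1 := taylor_isLittleO (convex_Ico 0 a) (⟨le_rfl, ha⟩ : (0 : ℝ) ∈ Ico 0 a) hf
    have h2 := (h1.mono (nhdsGT_le a ha)).tendsto_div_nhds_zero
    simpa [hP] using h2
  · intro r _
    simp

lemma i_to_ii {p : ℕ} (hp : 1 ≤ p) (a : ℝ) (ha : 0 < a) (n : ℕ)
    (q : EuclideanSpace ℝ (Fin p) → ℝ) (f : ℝ → ℝ)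
    (hrad : ∀ x ∈ Metric.ball (0 : EuclideanSpace ℝ (Fin p)) a, q x = f ‖x‖)
    (hq : ContDiffOn ℝ n q (Metric.ball (0 : EuclideanSpace ℝ (Fin p)) a)) :
    (ContDiffOn ℝ n f (Set.Ico 0 a) ∧
        ∀ k : ℕ, Odd k → k ≤ n → iteratedDerivWithin k f (Set.Ico 0 a) 0 = 0) := by
  let e : EuclideanSpace ℝ (Fin p) := EuclideanSpace.single ⟨0, hp⟩ 1
  have he : ‖e‖ = 1 := by simp [e]
  let g : ℝ → ℝ := fun t => q (t • e)
  have hm : ∀ t ∈ Ioo (-a) a, t • e ∈ Metric.ball (0 : EuclideanSpace ℝ (Fin p)) a := by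
    intro t ht
    simpa [norm_smul, he, abs_lt] using ht
  have hgf : ∀ t ∈ Ioo (-a) a, g t = f |t| := by
    intro t ht
    simp only [g]
    rw [hrad _ (hm t ht), norm_smul, he, mul_one, Real.norm_eq_abs]
  have hg : ContDiffOn ℝ n g (Ioo (-a) a) :=
    hq.comp (contDiff_id.smul contDiff_const).contDiffOn hm
  have hsub : Ico 0 a ⊆ Ioo (-a) a := fun t ht => ⟨by linarith [ht.1], ht.2⟩
  have heq : EqOn f g (Ico 0 a) := by
    intro t ht
    rw [hgf t (hsub ht), abs_of_nonneg ht.1]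
  refine ⟨(hg.mono hsub).congr heq, fun k hk hkn => ?_⟩
  have h0 : (0 : ℝ) ∈ Ico 0 a := ⟨le_rfl, ha⟩
  have hnh : Ioo (-a) a ∈ 𝓝 (0 : ℝ) := Ioo_mem_nhds (by linarith) ha
  rw [iteratedDerivWithin_congr heq h0, iteratedDerivWithin_eq_iteratedDeriv (uniqueDiffOn_Ico 0 a)
    ((hg.contDiffAt hnh).of_le (by exact_mod_cast hkn)) h0]
  have h1 := iteratedDeriv_comp_neg k g 0
  have h2 : (fun x => g (-x)) =ᶠ[𝓝 0] g := by
    filter_upwards [hnh] with t ht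
    rw [hgf t ht, hgf (-t) ⟨by linarith [ht.2], by linarith [ht.1]⟩, abs_neg]
  rw [h2.iteratedDeriv_eq, hk.neg_one_pow] at h1
  simp at h1
  linarith

theorem stmt0
    (p : ℕ) (hp : 1 ≤ p) (a₀ : ℝ) (ha₀ : 0 < a₀) (n : ℕ)
    (q : EuclideanSpace ℝ (Fin p) → ℝ) (qbar : ℝ → ℝ)
    (hrad : ∀ x ∈ Metric.ball (0 : EuclideanSpace ℝ (Fin p)) a₀, q x = qbar ‖x‖) :
    (ContDiffOn ℝ n q (Metric.ball (0 : EuclideanSpace ℝ (Fin p)) a₀) ↔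
      (ContDiffOn ℝ n qbar (Set.Ico 0 a₀) ∧
        ∀ k : ℕ, Odd k → k ≤ n → iteratedDerivWithin k qbar (Set.Ico 0 a₀) 0 = 0)) ∧
    (ContDiffOn ℝ n q (Metric.ball (0 : EuclideanSpace ℝ (Fin p)) a₀) ↔
      ∃ (P : Polynomial ℝ) (Φ : ℝ → ℝ),
        P.natDegree ≤ n / 2 ∧
        ContDiffOn ℝ n Φ (Set.Ico 0 a₀) ∧
        Filter.Tendsto (fun r => Φ r / r ^ n) (nhdsWithin 0 (Set.Ioi 0)) (nhds 0) ∧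
        ∀ r ∈ Set.Ico 0 a₀, qbar r = P.eval (r ^ 2) + Φ r) := by
  have h12 := i_to_ii hp a₀ ha₀ n q qbar hrad
  have h23 := ii_to_iii a₀ ha₀ n qbar
  have h31 : (∃ (P : Polynomial ℝ) (Φ : ℝ → ℝ),
        P.natDegree ≤ n / 2 ∧
        ContDiffOn ℝ n Φ (Set.Ico 0 a₀) ∧
        Filter.Tendsto (fun r => Φ r / r ^ n) (nhdsWithin 0 (Set.Ioi 0)) (nhds 0) ∧
        ∀ r ∈ Set.Ico 0 a₀, qbar r = P.eval (r ^ 2) + Φ r) →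
      ContDiffOn ℝ n q (Metric.ball (0 : EuclideanSpace ℝ (Fin p)) a₀) := by
    rintro ⟨P, Φ, -, hΦ, ht, heq⟩
    have ho : Φ =o[𝓝[>] 0] fun r => r ^ n := by
      refine (isLittleO_iff_tendsto' ?_).2 ht
      filter_upwards [self_mem_nhdsWithin] with r hr h
      exact absurd h (pow_ne_zero _ (ne_of_gt hr))
    have h1 := iii_to_i (E := EuclideanSpace ℝ (Fin p)) a₀ ha₀ n Φ hΦ ho
    have h2 : ContDiff ℝ n (fun x : EuclideanSpace ℝ (Fin p) => P.eval (‖x‖ ^ 2)) :=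
      (poly_contDiff P n).comp (contDiff_norm_sq ℝ)
    refine (h2.contDiffOn.add h1).congr fun x hx => ?_
    rw [hrad x hx, heq _ ⟨norm_nonneg _, by simpa using hx⟩]
  exact ⟨⟨h12, fun h => h31 (h23 h.1 h.2)⟩, ⟨fun h => h23 (h12 h).1 (h12 h).2, h31⟩⟩
end

section
/- Let W ⊂ ℝ² × ℝ^q (q ≥ 0) be an open connected neighbourhood of the axis A := {x₁ = x₂ = 0} that is invariant under rotations in the (x₁,x₂)-plane, and let q : W \ A → ℝ be radially symmetric in (x₁,x₂), i.e. q depends on (x₁,x₂) only through √(x₁²+x₂²). If the functions x₁·q and x₂·q extend to C^n functions on W with n ≥ 1, then q extends to a C^{n−1} function on W. -/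
open Filter Topology Set in
theorem aux_param_integral {E : Type} [NormedAddCommGroup E] [NormedSpace ℝ E]
    [ProperSpace E] (k : ℕ) : ∀ {F : Type} [NormedAddCommGroup F] [NormedSpace ℝ F]
    [CompleteSpace F]
    (H : E × ℝ → F), ContDiff ℝ k H → ContDiff ℝ k (fun x => ∫ t in (0:ℝ)..1, H (x, t)) := by
  induction k with
  | zero =>
    intro F _ _ _ H hH
    have hc : Continuous H := hH.continuous
    refine contDiff_zero.2 ?_
    exact intervalIntegral.continuous_parametric_intervalIntegral_of_continuous'
      (f := fun x t => H (x, t)) (by exact hc) 0 1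
  | succ k ih =>
    intro F _ _ _ H hH
    have hc : Continuous H := hH.continuous
    have hH' : ContDiff ℝ ((k : WithTop ℕ∞) + 1) H := by exact_mod_cast hH
    have hd : ContDiff ℝ k
        (fun p : E × ℝ => (fderiv ℝ H p).comp (ContinuousLinearMap.inl ℝ E ℝ)) :=
      (hH'.fderiv_right le_rfl).clm_comp contDiff_const
    have hdc := hd.continuous
    have hder : ∀ x₀ : E, HasFDerivAt (fun x => ∫ t in (0:ℝ)..1, H (x, t))
        (∫ t in (0:ℝ)..1, (fderiv ℝ H (x₀, t)).comp (ContinuousLinearMap.inl ℝ E ℝ)) x₀ := by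
      intro x₀
      obtain ⟨C, hC⟩ := ((isCompact_closedBall x₀ 1).prod
        (isCompact_Icc (a := (0:ℝ)) (b := 1))).exists_bound_of_continuousOn hdc.continuousOn
      refine intervalIntegral.hasFDerivAt_integral_of_dominated_of_fderiv_le
        (F := fun x t => H (x, t))
        (F' := fun x t => (fderiv ℝ H (x, t)).comp (ContinuousLinearMap.inl ℝ E ℝ))
        (bound := fun _ => C) (Metric.closedBall_mem_nhds x₀ one_pos) ?_ ?_ ?_ ?_ ?_ ?_
      · exact Eventually.of_forall fun x =>
          (hc.comp (by fun_prop : Continuous fun t : ℝ => (x, t))).aestronglyMeasurable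
      · exact (hc.comp (by fun_prop : Continuous fun t : ℝ => (x₀, t))).intervalIntegrable _ _
      · exact (hdc.comp (by fun_prop : Continuous fun t : ℝ => (x₀, t))).aestronglyMeasurable
      · refine Eventually.of_forall fun t ht x hx => hC (x, t) ⟨hx, ?_⟩
        rw [uIoc_of_le zero_le_one] at ht
        exact ⟨ht.1.le, ht.2⟩
      · exact intervalIntegrable_const
      · refine Eventually.of_forall fun t ht x hx => ?_
        exact ((hH'.differentiable (by simp)) (x, t)).hasFDerivAt.comp x
          (hasFDerivAt_prodMk_left x t)
    have : ContDiff ℝ ((k : WithTop ℕ∞) + 1) (fun x => ∫ t in (0:ℝ)..1, H (x, t)) := by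
      rw [contDiff_succ_iff_hasFDerivAt]
      exact ⟨_, ih _ hd, hder⟩
    exact_mod_cast this

open Filter Topology Set in
theorem aux_hadamard {E : Type} [NormedAddCommGroup E] [NormedSpace ℝ E]
    [ProperSpace E] (k : ℕ) (F : ℝ × E → ℝ) (hF : ContDiff ℝ (k + 1) F)
    (h0 : ∀ y, F (0, y) = 0) :
    ∃ G : ℝ × E → ℝ, ContDiff ℝ k G ∧ ∀ p, F p = p.1 * G p := by
  have hd : ContDiff ℝ k (fun z : (ℝ × E) × ℝ => fderiv ℝ F (z.2 * z.1.1, z.1.2) (1, 0)) :=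
    ((hF.fderiv_right le_rfl).comp
      (by fun_prop : ContDiff ℝ k fun z : (ℝ × E) × ℝ => (z.2 * z.1.1, z.1.2))).clm_apply
      contDiff_const
  refine ⟨_, aux_param_integral k _ hd, ?_⟩
  rintro ⟨x, y⟩
  have key : ∀ t : ℝ, HasDerivAt (fun t : ℝ => F (t * x, y))
      (x * fderiv ℝ F (t * x, y) (1, 0)) t := by
    intro t
    have h1 : HasDerivAt (fun t : ℝ => (t * x, y)) ((x, 0) : ℝ × E) t := by
      simpa using ((hasDerivAt_id t).mul_const x).prodMk (hasDerivAt_const t y)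
    have h2 := ((hF.differentiable (by simp)) (t * x, y)).hasFDerivAt.comp_hasDerivAt t h1
    have h3 : ((x, 0) : ℝ × E) = x • ((1, 0) : ℝ × E) := by simp
    rw [h3, map_smul, smul_eq_mul] at h2
    exact h2
  have hint := intervalIntegral.integral_eq_sub_of_hasDerivAt (a := 0) (b := 1)
    (fun t _ => key t) ?_
  · simp only [one_mul, zero_mul, h0, sub_zero, intervalIntegral.integral_const_mul] at hint
    exact hint.symm
  · apply Continuous.intervalIntegrable
    exact continuous_const.mul
      (hd.continuous.comp (by fun_prop : Continuous fun t : ℝ => (((x, y), t) : (ℝ × E) × ℝ)))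

open Filter Topology Set in

/-- Lemma `Analy`.
Let `W ⊂ ℝ² × ℝ^q` be an open connected, rotationally invariant neighbourhood of
the axis `A = {x₁ = x₂ = 0}`, and let `q : W \ A → ℝ` be radially symmetric in
`(x₁,x₂)`.  If `x₁·q` and `x₂·q` extend to `C^n` functions on `W` (`n ≥ 1`),
then `q` extends to a `C^{n-1}` function on `W`. -/
theorem stmt1 (qd : ℕ) (n : ℕ) (hn : 1 ≤ n)
    (W A : Set (ℝ × ℝ × EuclideanSpace ℝ (Fin qd)))
    (hA : A = {x : ℝ × ℝ × EuclideanSpace ℝ (Fin qd) | x.1 = 0 ∧ x.2.1 = 0})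
    (hWopen : IsOpen W) (hWconn : IsConnected W) (hAW : A ⊆ W)
    (hWrot : ∀ x ∈ W, ∀ a b : ℝ,
      a ^ 2 + b ^ 2 = x.1 ^ 2 + x.2.1 ^ 2 → ((a, b, x.2.2) : ℝ × ℝ × EuclideanSpace ℝ (Fin qd)) ∈ W)
    (q : (ℝ × ℝ × EuclideanSpace ℝ (Fin qd)) → ℝ)
    (hqrad : ∀ x ∈ W \ A, ∀ y ∈ W \ A,
      x.1 ^ 2 + x.2.1 ^ 2 = y.1 ^ 2 + y.2.1 ^ 2 → x.2.2 = y.2.2 → q x = q y)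
    (F₁ F₂ : (ℝ × ℝ × EuclideanSpace ℝ (Fin qd)) → ℝ)
    (hF₁ : ContDiffOn ℝ n F₁ W) (hF₂ : ContDiffOn ℝ n F₂ W)
    (hF₁q : ∀ x ∈ W \ A, F₁ x = x.1 * q x)
    (hF₂q : ∀ x ∈ W \ A, F₂ x = x.2.1 * q x) :
    ∃ Q : (ℝ × ℝ × EuclideanSpace ℝ (Fin qd)) → ℝ,
      ContDiffOn ℝ (n - 1) Q W ∧ ∀ x ∈ W \ A, Q x = q x := by
  obtain ⟨m, rfl⟩ : ∃ m, n = m + 1 := ⟨n - 1, by omega⟩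
  have hnm : (((m + 1 : ℕ) : WithTop ℕ∞) - 1) = (m : WithTop ℕ∞) := by
    norm_cast
  rw [hnm]
  have hmle : (m : WithTop ℕ∞) ≤ ((m + 1 : ℕ) : WithTop ℕ∞) := by
    exact_mod_cast Nat.le_succ m
  have hAiff : ∀ x, x ∈ A ↔ x.1 = 0 ∧ x.2.1 = 0 := by intro x; rw [hA]; rfl
  let V := EuclideanSpace ℝ (Fin qd)
  -- `F₁` vanishes on `x₁ = 0`
  have hzero : ∀ y : ℝ × V, ((0, y) : ℝ × ℝ × V) ∈ W → F₁ (0, y) = 0 := by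
    rintro ⟨s, w⟩ hW
    by_cases hs : s = 0
    · subst hs
      have hcF : ContinuousAt F₁ ((0, 0, w) : ℝ × ℝ × V) :=
        hF₁.continuousOn.continuousAt (hWopen.mem_nhds hW)
      have hc : Continuous (fun s : ℝ => ((0, s, w) : ℝ × ℝ × V)) := by fun_prop
      have h1 : Tendsto (fun s : ℝ => F₁ (0, s, w)) (𝓝[≠] 0) (𝓝 (F₁ (0, 0, w))) :=
        (ContinuousAt.comp (f := fun s : ℝ => ((0, s, w) : ℝ × ℝ × V)) (x := 0) hcF
          hc.continuousAt).tendsto.mono_left nhdsWithin_le_nhds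
      have h2 : Tendsto (fun s : ℝ => F₁ (0, s, w)) (𝓝[≠] 0) (𝓝 0) := by
        refine tendsto_const_nhds.congr' ?_
        have hev : ∀ᶠ s in 𝓝 (0 : ℝ), ((0, s, w) : ℝ × ℝ × V) ∈ W :=
          hc.continuousAt.eventually (hWopen.mem_nhds hW)
        filter_upwards [hev.filter_mono nhdsWithin_le_nhds, self_mem_nhdsWithin] with s hs hs0
        rw [hF₁q _ ⟨hs, fun h => hs0 ((hAiff _).1 h).2⟩]
        simp
      exact tendsto_nhds_unique h1 h2
    · rw [hF₁q _ ⟨hW, fun h => hs ((hAiff _).1 h).2⟩]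
      simp
  -- local extensions
  have hloc : ∀ x ∈ W, ∃ g : ℝ × ℝ × V → ℝ, ContDiffAt ℝ m g x ∧
      ∀ᶠ y in 𝓝 x, y.1 ≠ 0 → q y = g y := by
    intro x hx
    have hxW := hWopen.mem_nhds hx
    let χ0 : ∃ r > 0, Metric.ball x r ⊆ W := Metric.isOpen_iff.1 hWopen x hx
    obtain ⟨r, hr, hball⟩ := χ0
    let χ : ContDiffBump x := ⟨r / 4, r / 2, by positivity, by linarith⟩
    have hsm : ContDiff ℝ ((m : WithTop ℕ∞) + 1) (fun y => χ y * F₁ y) := by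
      rw [contDiff_iff_contDiffAt]
      intro y
      by_cases hy : y ∈ W
      · refine χ.contDiff.contDiffAt.mul ?_
        exact_mod_cast hF₁.contDiffAt (hWopen.mem_nhds hy)
      · have : ∀ᶠ z in 𝓝 y, χ z * F₁ z = 0 := by
          have hy' : y ∈ (Metric.closedBall x (r / 2))ᶜ := fun h =>
            hy (hball (Metric.closedBall_subset_ball (by linarith) h))
          filter_upwards [Metric.isClosed_closedBall.isOpen_compl.mem_nhds hy'] with z hz
          rw [χ.zero_of_le_dist, zero_mul]
          simp only [mem_compl_iff, Metric.mem_closedBall, not_le] at hz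
          exact hz.le
        exact (contDiffAt_const (c := (0 : ℝ))).congr_of_eventuallyEq this
    obtain ⟨G, hG, hGeq⟩ := aux_hadamard m _ hsm (fun y => by
      by_cases hy : ((0, y) : ℝ × ℝ × V) ∈ W
      · simp [hzero y hy]
      · have : χ ((0, y) : ℝ × ℝ × V) = 0 := by
          apply χ.zero_of_le_dist
          by_contra h
          exact hy (hball (by
            rw [Metric.mem_ball]
            have : dist ((0, y) : ℝ × ℝ × V) x < r / 2 := not_le.1 h
            linarith))
        simp [this])
    refine ⟨G, hG.contDiffAt, ?_⟩
    filter_upwards [χ.eventuallyEq_one, hxW] with y h1 hyW hy0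
    have h2 := hGeq y
    rw [h1, hF₁q y ⟨hyW, fun h => hy0 ((hAiff _).1 h).1⟩] at h2
    simp only [Pi.one_apply, one_mul] at h2
    exact mul_left_cancel₀ hy0 h2
  -- density
  have hNe : ∀ x : ℝ × ℝ × V, (𝓝[{y : ℝ × ℝ × V | y.1 ≠ 0}] x).NeBot := by
    intro x
    rw [← mem_closure_iff_nhdsWithin_neBot]
    have : {y : ℝ × ℝ × V | y.1 ≠ 0} = ({0}ᶜ : Set ℝ) ×ˢ (univ : Set (ℝ × V)) := by
      ext y; simp
    rw [this, closure_prod_eq, (dense_compl_singleton (0 : ℝ)).closure_eq]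
    simp
  have hlim : ∀ (x : ℝ × ℝ × V) (g : ℝ × ℝ × V → ℝ), ContinuousAt g x →
      (∀ᶠ y in 𝓝 x, y.1 ≠ 0 → q y = g y) →
      limUnder (𝓝[{y : ℝ × ℝ × V | y.1 ≠ 0}] x) q = g x := by
    intro x g hg hev
    haveI := hNe x
    refine Tendsto.limUnder_eq ?_
    refine (hg.tendsto.mono_left nhdsWithin_le_nhds).congr' ?_
    filter_upwards [hev.filter_mono nhdsWithin_le_nhds, self_mem_nhdsWithin] with y h1 h2
    exact (h1 h2).symm
  refine ⟨fun x => limUnder (𝓝[{y : ℝ × ℝ × V | y.1 ≠ 0}] x) q, ?_, ?_⟩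
  · intro x hx
    obtain ⟨g, hg, hev⟩ := hloc x hx
    refine (hg.congr_of_eventuallyEq ?_).contDiffWithinAt
    have hgc : ∀ᶠ y in 𝓝 x, ContinuousAt g y :=
      (hg.eventually (by simp)).mono fun y hy => hy.continuousAt
    filter_upwards [hgc, hev.eventually_nhds] with y h1 h2
    exact hlim y g h1 h2
  · intro x hx
    refine hlim x q ?_ (Eventually.of_forall fun _ _ => rfl)
    have hxW := hWopen.mem_nhds hx.1
    by_cases h1 : x.1 = 0
    · have h2 : x.2.1 ≠ 0 := fun h2 => hx.2 ((hAiff x).2 ⟨h1, h2⟩)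
      have hcd : ContinuousAt (fun y : ℝ × ℝ × V => F₂ y / y.2.1) x :=
        (hF₂.continuousOn.continuousAt hxW).div (by fun_prop) h2
      refine hcd.congr ?_
      have hne : ∀ᶠ y : ℝ × ℝ × V in 𝓝 x, y.2.1 ≠ 0 :=
        ContinuousAt.eventually_ne (by fun_prop) h2
      filter_upwards [hne, hxW] with y hy hyW
      rw [hF₂q y ⟨hyW, fun h => hy ((hAiff y).1 h).2⟩]
      field_simp
    · have hcd : ContinuousAt (fun y : ℝ × ℝ × V => F₁ y / y.1) x :=
        (hF₁.continuousOn.continuousAt hxW).div (by fun_prop) h1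
      refine hcd.congr ?_
      have hne : ∀ᶠ y : ℝ × ℝ × V in 𝓝 x, y.1 ≠ 0 :=
        ContinuousAt.eventually_ne (by fun_prop) h1
      filter_upwards [hne, hxW] with y hy hyW
      rw [hF₁q y ⟨hyW, fun h => hy ((hAiff y).1 h).1⟩]
      field_simp
end

section
/- Let f : B^p → ℝ be radially symmetric. If f is C^n on B^p and f(x) = o(|x|^n) as |x| → 0, with n ≥ 0, then for each i ∈ {1,…,p} the function x ↦ (x_i/|x|) f(x) (extended by 0 at the origin) is C^n on B^p and o(|x|^n) as |x| → 0. -/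
open Filter Topology Asymptotics

/-- Iterated finite difference. -/
def fdiff {E F : Type} [AddCommGroup E] [AddCommGroup F] :
    (m : ℕ) → (Fin m → E) → (E → F) → E → F
  | 0, _, f => f
  | (m + 1), v, f => fun x =>
      fdiff m (Fin.init v) f (x + v (Fin.last m)) - fdiff m (Fin.init v) f x

section
variable {E : Type} [NormedAddCommGroup E] [NormedSpace ℝ E]

lemma fdiff_bound {F : Type} [NormedAddCommGroup F] (R C : ℝ) (f : E → F)
    (hf : ∀ y, ‖y‖ ≤ R → ‖f y‖ ≤ C) (m : ℕ) : ∀ (v : Fin m → E) (x : E),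
    ‖x‖ + ∑ i, ‖v i‖ ≤ R → ‖fdiff m v f x‖ ≤ 2 ^ m * C := by
  induction m with
  | zero => intro v x hx; simpa [fdiff] using hf x (by simpa using hx)
  | succ m ih =>
    intro v x hx
    rw [Fin.sum_univ_castSucc] at hx
    have h1 := ih (Fin.init v) (x + v (Fin.last m)) (by
      have := norm_add_le x (v (Fin.last m))
      simp only [Fin.init]; linarith)
    have h2 := ih (Fin.init v) x (by
      have := norm_nonneg (v (Fin.last m))
      simp only [Fin.init]; linarith)
    simp only [fdiff]
    refine (norm_sub_le _ _).trans ?_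
    rw [pow_succ]; linarith

lemma fdiff_hasFDerivAt {F : Type} [NormedAddCommGroup F] [NormedSpace ℝ F] (R : ℝ) (f : E → F)
    (hf : ∀ y, ‖y‖ < R → DifferentiableAt ℝ f y) (m : ℕ) : ∀ (v : Fin m → E) (x : E),
    ‖x‖ + ∑ i, ‖v i‖ < R → HasFDerivAt (fdiff m v f) (fdiff m v (fderiv ℝ f) x) x := by
  induction m with
  | zero => intro v x hx; simpa [fdiff] using (hf x (by simpa using hx)).hasFDerivAt
  | succ m ih =>
    intro v x hx
    rw [Fin.sum_univ_castSucc] at hx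
    have h1 := ih (Fin.init v) (x + v (Fin.last m)) (by
      have := norm_add_le x (v (Fin.last m))
      simp only [Fin.init]; linarith)
    have h2 := ih (Fin.init v) x (by
      have := norm_nonneg (v (Fin.last m))
      simp only [Fin.init]; linarith)
    simp only [fdiff]
    have h3 : HasFDerivAt (fun y => fdiff m (Fin.init v) f (y + v (Fin.last m)))
        (fdiff m (Fin.init v) (fderiv ℝ f) (x + v (Fin.last m))) x :=
      (hasFDerivAt_comp_add_right (v (Fin.last m))).2 h1
    exact h3.sub h2

lemma fderiv_step {F : Type} [NormedAddCommGroup F] [NormedSpace ℝ F] {n : ℕ} {s : Set E}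
    (hs : IsOpen s) {f : E → F} (hf : ContDiffOn ℝ (n + 1 : ℕ) f s) :
    DifferentiableOn ℝ f s ∧ ContDiffOn ℝ n (fderiv ℝ f) s := by
  push_cast at hf
  rw [contDiffOn_succ_iff_fderiv_of_isOpen hs] at hf
  exact ⟨hf.1, hf.2.2⟩

lemma fdiff_approx (R ε : ℝ) (hε : 0 ≤ ε) (m : ℕ) :
    ∀ {F : Type} [NormedAddCommGroup F] [NormedSpace ℝ F] (f : E → F)
    (_ : ContDiffOn ℝ m f (Metric.ball 0 R))
    (_ : ∀ y, ‖y‖ < R → ‖iteratedFDeriv ℝ m f y - iteratedFDeriv ℝ m f 0‖ ≤ ε)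
    (v : Fin m → E) (x : E), ‖x‖ + ∑ i, ‖v i‖ < R →
    ‖fdiff m v f x - iteratedFDeriv ℝ m f 0 v‖ ≤ ε * ∏ i, ‖v i‖ := by
  induction m with
  | zero =>
    intro F _ _ f hf h v x hx
    have h1 := h x (by simpa using hx)
    have h2 := (iteratedFDeriv ℝ 0 f x - iteratedFDeriv ℝ 0 f 0).le_opNorm v
    simp only [ContinuousMultilinearMap.sub_apply, iteratedFDeriv_zero_apply] at h2
    simp only [fdiff, iteratedFDeriv_zero_apply]
    refine h2.trans ?_
    gcongr
  | succ m ih =>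
    intro F _ _ f hf h v x hx
    rw [Fin.sum_univ_castSucc] at hx
    obtain ⟨hd, hf'⟩ := fderiv_step Metric.isOpen_ball hf
    have hd' : ∀ y, ‖y‖ < R → DifferentiableAt ℝ f y := fun y hy =>
      hd.differentiableAt (Metric.isOpen_ball.mem_nhds (by simpa using hy))
    have h' : ∀ y, ‖y‖ < R →
        ‖iteratedFDeriv ℝ m (fderiv ℝ f) y - iteratedFDeriv ℝ m (fderiv ℝ f) 0‖ ≤ ε := by
      intro y hy
      have := h y hy
      rw [iteratedFDeriv_succ_eq_comp_right, iteratedFDeriv_succ_eq_comp_right] at this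
      simp only [Function.comp_apply] at this
      rw [← dist_eq_norm] at this ⊢
      rwa [← (continuousMultilinearCurryRightEquiv' ℝ m E F).symm.dist_map]
    have key := ih (fderiv ℝ f) hf' h' (Fin.init v)
    set φ := iteratedFDeriv ℝ m (fderiv ℝ f) 0 (Fin.init v) with hφ
    have hE : iteratedFDeriv ℝ (m + 1) f 0 v = φ (v (Fin.last m)) := by
      rw [iteratedFDeriv_succ_apply_right]
    have hlt : ∀ y ∈ Metric.closedBall x ‖v (Fin.last m)‖,
        ‖y‖ + ∑ i, ‖Fin.init v i‖ < R := by
      intro y hy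
      have h1 : ‖y - x‖ ≤ ‖v (Fin.last m)‖ := by simpa [dist_eq_norm] using hy
      have h2 := norm_le_norm_add_norm_sub' y x
      simp only [Fin.init]; linarith
    have := Convex.norm_image_sub_le_of_norm_hasFDerivWithin_le' (φ := φ)
      (C := ε * ∏ i, ‖Fin.init v i‖) (x := x) (y := x + v (Fin.last m))
      (fun y hy => (fdiff_hasFDerivAt R f hd' m (Fin.init v) y (hlt y hy)).hasFDerivWithinAt)
      (fun y hy => key y (hlt y hy)) (convex_closedBall x ‖v (Fin.last m)‖)
      (by simp) (by simp)
    rw [hE, Fin.prod_univ_castSucc]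
    simp only [fdiff]
    simpa [Fin.init, mul_assoc] using this

lemma iteratedFDeriv_contAt {F : Type} [NormedAddCommGroup F] [NormedSpace ℝ F] {n k : ℕ}
    (hk : k ≤ n) {s : Set E} (hs : IsOpen s) {f : E → F} (hf : ContDiffOn ℝ n f s) :
    ContinuousOn (iteratedFDeriv ℝ k f) s :=
  (hf.continuousOn_iteratedFDerivWithin (m := k) (by exact_mod_cast hk) hs.uniqueDiffOn).congr
    (fun x hx => (iteratedFDerivWithin_of_isOpen k hs hx).symm)

lemma iteratedFDeriv_zero_of_isLittleO {F : Type} [NormedAddCommGroup F] [NormedSpace ℝ F]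
    {m : ℕ} {r : ℝ} (hr : 0 < r) (f : E → F) (hf : ContDiffOn ℝ m f (Metric.ball 0 r))
    (ho : f =o[𝓝 0] fun x => ‖x‖ ^ m) : iteratedFDeriv ℝ m f 0 = 0 := by
  ext v
  simp only [ContinuousMultilinearMap.zero_apply]
  set T := iteratedFDeriv ℝ m f 0 with hT
  set S := ∑ i, ‖v i‖ with hS
  have hS0 : 0 ≤ S := Finset.sum_nonneg fun _ _ => norm_nonneg _
  set K := ∏ i, ‖v i‖ + 2 ^ m * S ^ m with hK
  have hmain : ∀ ε : ℝ, 0 < ε → ‖T v‖ ≤ ε * K := by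
    intro ε hε
    have hc : ContinuousAt (iteratedFDeriv ℝ m f) 0 :=
      (iteratedFDeriv_contAt le_rfl Metric.isOpen_ball hf).continuousAt
        (Metric.ball_mem_nhds 0 hr)
    have e1 : ∀ᶠ y in 𝓝 (0 : E), ‖iteratedFDeriv ℝ m f y - T‖ ≤ ε := by
      have := Metric.continuousAt_iff'.1 hc ε hε
      filter_upwards [this] with y hy
      rw [dist_eq_norm] at hy
      exact hy.le
    have e2 := ho.def hε
    obtain ⟨δ, hδ, hδ'⟩ := Metric.eventually_nhds_iff_ball.1 (e1.and e2)
    set R := min δ r with hR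
    have hRpos : 0 < R := lt_min hδ hr
    obtain ⟨t, ht, htS⟩ : ∃ t : ℝ, 0 < t ∧ t * S < R := by
      refine ⟨R / (S + 1), by positivity, ?_⟩
      rw [div_mul_eq_mul_div, div_lt_iff₀ (by positivity)]
      nlinarith
    have hsum : ∑ i, ‖(t • v) i‖ = t * S := by
      simp [norm_smul, abs_of_pos ht, hS, Finset.mul_sum]
    have hprod : ∏ i, ‖(t • v) i‖ = t ^ m * ∏ i, ‖v i‖ := by
      simp [norm_smul, abs_of_pos ht, Finset.prod_mul_distrib]
    have a1 := fdiff_approx R ε hε.le m f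
      (hf.mono (Metric.ball_subset_ball (min_le_right _ _)))
      (fun y hy => (hδ' y (by simpa using hy.trans_le (min_le_left _ _))).1) (t • v) 0
      (by rw [hsum]; simpa using htS)
    have a2 := fdiff_bound (t * S) (ε * (t * S) ^ m) f (fun y hy => by
      have := (hδ' y (by simpa using (hy.trans_lt htS).trans_le (min_le_left _ _))).2
      refine this.trans ?_
      rw [norm_pow, norm_norm]
      gcongr) m (t • v) 0 (by rw [hsum]; simp)
    have a3 : T (t • v) = t ^ m • T v := by
      have := T.map_smul_univ (fun _ => t) v
      simp only [Finset.prod_const, Finset.card_univ, Fintype.card_fin] at this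
      exact this
    rw [hprod, ← hT, a3] at a1
    have a4 : ‖t ^ m • T v‖ ≤ t ^ m * (ε * K) := by
      have := norm_sub_norm_le (t ^ m • T v) (fdiff m (t • v) f 0)
      rw [norm_sub_rev] at this
      have e : t ^ m * (ε * K) = ε * (t ^ m * ∏ i, ‖v i‖) + 2 ^ m * (ε * (t * S) ^ m) := by
        rw [hK, mul_pow]; ring
      rw [e]; linarith
    rw [norm_smul, norm_pow, Real.norm_of_nonneg ht.le] at a4
    exact le_of_mul_le_mul_left a4 (by positivity)
  have hK0 : 0 ≤ K := by positivity
  have : ‖T v‖ ≤ 0 := by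
    refine le_of_forall_pos_le_add fun η hη => ?_
    have := hmain (η / (K + 1)) (by positivity)
    refine this.trans ?_
    rw [zero_add, div_mul_eq_mul_div, div_le_iff₀ (by positivity)]
    nlinarith
  exact norm_le_zero_iff.1 this

lemma norm_iter_fderiv {F : Type} [NormedAddCommGroup F] [NormedSpace ℝ F] (k : ℕ) (f : E → F)
    (x : E) : ‖iteratedFDeriv ℝ k (fderiv ℝ f) x‖ = ‖iteratedFDeriv ℝ (k + 1) f x‖ :=
  norm_iteratedFDeriv_fderiv

lemma iter_isLittleO {r : ℝ} (hr : 0 < r) (n : ℕ) :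
    ∀ {F : Type} [NormedAddCommGroup F] [NormedSpace ℝ F] (f : E → F)
    (_ : ContDiffOn ℝ n f (Metric.ball 0 r))
    (_ : ∀ k ≤ n, iteratedFDeriv ℝ k f 0 = 0),
    ∀ k ≤ n, (fun x => ‖iteratedFDeriv ℝ k f x‖) =o[𝓝 0] fun x => ‖x‖ ^ (n - k) := by
  induction n with
  | zero =>
    intro F _ _ f hf h k hk
    obtain rfl : k = 0 := by omega
    have hc : ContinuousAt (iteratedFDeriv ℝ 0 f) 0 :=
      (iteratedFDeriv_contAt le_rfl Metric.isOpen_ball hf).continuousAt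
        (Metric.ball_mem_nhds 0 hr)
    simp only [Nat.sub_self, pow_zero]
    rw [isLittleO_one_iff]
    have := hc.norm.tendsto
    rwa [h 0 le_rfl, norm_zero] at this
  | succ n ih =>
    intro F _ _ f hf h k hk
    obtain ⟨hd, hf'⟩ := fderiv_step Metric.isOpen_ball hf
    have h' : ∀ k ≤ n, iteratedFDeriv ℝ k (fderiv ℝ f) 0 = 0 := by
      intro k hk
      rw [← norm_eq_zero, norm_iter_fderiv, h (k + 1) (by omega), norm_zero]
    have key := ih (fderiv ℝ f) hf' h'
    rcases k with _ | k
    · have k0 := key 0 (by omega)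
      simp only [norm_iteratedFDeriv_zero, Nat.sub_zero] at k0 ⊢
      have f0 : f 0 = 0 := by
        have := h 0 (by omega)
        rw [← norm_eq_zero, norm_iteratedFDeriv_zero, norm_eq_zero] at this
        exact this
      rw [isLittleO_iff]
      intro c hc
      obtain ⟨δ, hδ, hδ'⟩ := Metric.eventually_nhds_iff_ball.1 (k0.def hc)
      filter_upwards [Metric.ball_mem_nhds 0 (lt_min hδ hr)] with x hx
      have hx' : ‖x‖ < min δ r := by simpa using hx
      have hy : ∀ y ∈ Metric.closedBall (0 : E) ‖x‖, ‖y‖ ≤ ‖x‖ := fun y hy => by simpa using hy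
      have := Convex.norm_image_sub_le_of_norm_fderiv_le (𝕜 := ℝ) (f := f) (C := c * ‖x‖ ^ n)
        (x := 0) (y := x) (s := Metric.closedBall (0 : E) ‖x‖)
        (fun y hyy => hd.differentiableAt (Metric.isOpen_ball.mem_nhds (by
          simpa using ((hy y hyy).trans_lt hx').trans_le (min_le_right _ _))))
        (fun y hyy => by
          have := hδ' y (by simpa using ((hy y hyy).trans_lt hx').trans_le (min_le_left _ _))
          rw [norm_norm, norm_pow, norm_norm] at this
          refine this.trans ?_
          have := hy y hyy
          gcongr)
        (convex_closedBall _ _) (by simp) (by simp)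
      rw [f0, sub_zero, sub_zero] at this
      rw [norm_norm, norm_pow, norm_norm, pow_succ, ← mul_assoc]
      exact this
    · have := key k (by omega)
      simp only [norm_iter_fderiv] at this
      rwa [Nat.add_sub_add_right]

lemma contDiffOn_of_punctured {r : ℝ} (hr : 0 < r) (n : ℕ) :
    ∀ {F : Type} [NormedAddCommGroup F] [NormedSpace ℝ F] (h : E → F) (_ : h 0 = 0)
    (_ : ContDiffOn ℝ n h (Metric.ball 0 r \ {0}))
    (_ : ∀ k ≤ n, (fun x => ‖iteratedFDeriv ℝ k h x‖) =o[𝓝[≠] 0] fun x => ‖x‖ ^ (n - k)),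
    ContDiffOn ℝ n h (Metric.ball 0 r) := by
  have hop : IsOpen (Metric.ball (0 : E) r \ {0}) :=
    Metric.isOpen_ball.sdiff isClosed_singleton
  induction n with
  | zero =>
    intro F _ _ h h0 hc ho
    have hc' := hc.continuousOn
    simp only [Nat.cast_zero, contDiffOn_zero]
    intro x hx
    apply ContinuousAt.continuousWithinAt
    by_cases hx0 : x = 0
    · subst hx0
      rw [continuousAt_iff_punctured_nhds, h0]
      have := ho 0 le_rfl
      simp only [norm_iteratedFDeriv_zero, Nat.sub_zero, pow_zero] at this
      rw [isLittleO_one_iff] at this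
      exact tendsto_zero_iff_norm_tendsto_zero.2 this
    · exact hc'.continuousAt (hop.mem_nhds ⟨hx, hx0⟩)
  | succ n ih =>
    intro F _ _ h h0 hc ho
    obtain ⟨hd, hf'⟩ := fderiv_step hop hc
    have hD0 : HasFDerivAt h (0 : E →L[ℝ] F) 0 := by
      rw [hasFDerivAt_iff_isLittleO_nhds_zero]
      simp only [zero_add, h0, sub_zero, ContinuousLinearMap.zero_apply]
      have h1 := ho 0 (by omega)
      simp only [norm_iteratedFDeriv_zero, Nat.sub_zero] at h1
      rw [isLittleO_iff]
      intro c hcc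
      have h2 := h1.def hcc
      rw [eventually_nhdsWithin_iff] at h2
      filter_upwards [h2, Metric.ball_mem_nhds (0 : E) one_pos] with x hx hx1
      by_cases hx0 : x = 0
      · simp [hx0, h0]
      · have := hx hx0
        rw [norm_norm, norm_pow, norm_norm] at this
        have hx1' : ‖x‖ ≤ 1 := by
          have : ‖x‖ < 1 := by simpa using hx1
          exact this.le
        refine this.trans ?_
        gcongr
        rw [pow_succ]
        exact mul_le_of_le_one_left (norm_nonneg _) (pow_le_one₀ (norm_nonneg _) hx1')
    have key := ih (fderiv ℝ h) hD0.fderiv hf' (fun k hk => by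
      have := ho (k + 1) (by omega)
      simp only [norm_iter_fderiv]
      rwa [Nat.add_sub_add_right] at this)
    push_cast
    rw [contDiffOn_succ_iff_fderiv_of_isOpen Metric.isOpen_ball]
    refine ⟨?_, by simp, key⟩
    intro x hx
    by_cases hx0 : x = 0
    · subst hx0
      exact hD0.differentiableAt.differentiableWithinAt
    · exact (hd.differentiableAt (hop.mem_nhds ⟨hx, hx0⟩)).differentiableWithinAt

/-- bounds on derivatives of a degree-0 homogeneous function. -/
lemma homog_bound_s2 [FiniteDimensional ℝ E] (g : E → ℝ) (hg : ∀ n : ℕ, ContDiffOn ℝ n g {0}ᶜ)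
    (hh : ∀ (t : ℝ) (x : E), 0 < t → g (t • x) = g x) (k : ℕ) :
    ∃ C : ℝ, 0 ≤ C ∧ ∀ x : E, x ≠ 0 → ‖iteratedFDeriv ℝ k g x‖ * ‖x‖ ^ k ≤ C := by
  have hop : IsOpen ({0}ᶜ : Set E) := isOpen_compl_singleton
  have hcont := (iteratedFDeriv_contAt le_rfl hop (hg k)).mono
    (t := Metric.sphere (0 : E) 1) (fun x hx => by
      rintro rfl; simp at hx)
  obtain ⟨C, hC⟩ := (isCompact_sphere (0 : E) 1).exists_bound_of_continuousOn hcont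
  refine ⟨max C 0, le_max_right _ _, fun x hx => ?_⟩
  have hx' : 0 < ‖x‖ := norm_pos_iff.2 hx
  have ht : 0 < ‖x‖⁻¹ := inv_pos.2 hx'
  let e : E ≃L[ℝ] E := ContinuousLinearEquiv.smulLeft (Units.mk0 ‖x‖⁻¹ ht.ne')
  have he : ∀ y, e y = ‖x‖⁻¹ • y := fun y => rfl
  have hcomp : g ∘ e = g := by
    funext y; simp only [Function.comp_apply, he]; exact hh _ _ ht
  have h1 := e.iteratedFDerivWithin_comp_right g uniqueDiffOn_univ (x := x) (Set.mem_univ _) k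
  rw [hcomp] at h1
  simp only [Set.preimage_univ, iteratedFDerivWithin_univ] at h1
  have h2 : ‖iteratedFDeriv ℝ k g x‖ ≤ C * ‖x‖⁻¹ ^ k := by
    have hb := hC (e x) (by simp [he, norm_smul, hx'.ne'])
    have hC0 : 0 ≤ C := (norm_nonneg _).trans hb
    refine ContinuousMultilinearMap.opNorm_le_bound (by positivity) fun m => ?_
    rw [h1, ContinuousMultilinearMap.compContinuousLinearMap_apply]
    refine ((iteratedFDeriv ℝ k g (e x)).le_opNorm _).trans ?_
    have : ∏ i, ‖(e : E →L[ℝ] E) (m i)‖ = ‖x‖⁻¹ ^ k * ∏ i, ‖m i‖ := by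
      simp [he, norm_smul, Finset.prod_mul_distrib]
    rw [this, ← mul_assoc]
    gcongr
  calc _ ≤ C * ‖x‖⁻¹ ^ k * ‖x‖ ^ k := by gcongr
    _ = C := by rw [mul_assoc, ← mul_pow, inv_mul_cancel₀ hx'.ne', one_pow, mul_one]
    _ ≤ _ := le_max_left _ _

lemma prod_isLittleO [FiniteDimensional ℝ E] {r : ℝ} (n : ℕ) (g f : E → ℝ)
    (hg : ∀ n : ℕ, ContDiffOn ℝ n g {0}ᶜ)
    (hh : ∀ (t : ℝ) (x : E), 0 < t → g (t • x) = g x) (hr : 0 < r)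
    (hf : ContDiffOn ℝ n f (Metric.ball 0 r))
    (ho : ∀ k ≤ n, (fun x => ‖iteratedFDeriv ℝ k f x‖) =o[𝓝 0] fun x => ‖x‖ ^ (n - k)) :
    ∀ k ≤ n, (fun x => ‖iteratedFDeriv ℝ k (fun x => g x * f x) x‖) =o[𝓝[≠] 0]
      fun x => ‖x‖ ^ (n - k) := by
  intro k hk
  have hop : IsOpen (Metric.ball (0 : E) r \ {0}) :=
    Metric.isOpen_ball.sdiff isClosed_singleton
  have hmem : Metric.ball (0 : E) r \ {0} ∈ 𝓝[≠] (0 : E) :=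
    Filter.inter_mem (mem_nhdsWithin_of_mem_nhds (Metric.ball_mem_nhds 0 hr)) self_mem_nhdsWithin
  have hbd : ∀ᶠ x in 𝓝[≠] (0 : E), ‖iteratedFDeriv ℝ k (fun x => g x * f x) x‖ ≤
      ∑ i ∈ Finset.range (k + 1), (k.choose i : ℝ) * ‖iteratedFDeriv ℝ i g x‖ *
        ‖iteratedFDeriv ℝ (k - i) f x‖ := by
    filter_upwards [hmem] with x hx
    have := norm_iteratedFDerivWithin_mul_le (𝕜 := ℝ) (N := (n : ℕ))
      ((hg n).mono (fun y hy => hy.2) : ContDiffOn ℝ n g (Metric.ball (0 : E) r \ {0}))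
      (hf.mono Set.sdiff_subset) hop.uniqueDiffOn hx (n := k) (by exact_mod_cast hk)
    simpa only [iteratedFDerivWithin_of_isOpen _ hop hx] using this
  suffices hsum : (fun x : E => ∑ i ∈ Finset.range (k + 1), (k.choose i : ℝ) *
      ‖iteratedFDeriv ℝ i g x‖ * ‖iteratedFDeriv ℝ (k - i) f x‖) =o[𝓝[≠] 0]
      fun x => ‖x‖ ^ (n - k) by
    refine IsBigO.trans_isLittleO (IsBigO.of_bound 1 ?_) hsum
    filter_upwards [hbd] with x hx
    rw [norm_norm, one_mul]
    exact hx.trans (le_abs_self _)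
  · apply IsLittleO.fun_sum
    intro i hi
    have hik : i ≤ k := by simp at hi; omega
    obtain ⟨C, hC0, hC⟩ := homog_bound_s2 g hg hh i
    have h1 : (fun x => (k.choose i : ℝ) * ‖iteratedFDeriv ℝ i g x‖) =O[𝓝[≠] (0 : E)]
        fun x => (‖x‖ ^ i)⁻¹ := by
      refine IsBigO.const_mul_left (IsBigO.of_bound C ?_) _
      filter_upwards [self_mem_nhdsWithin] with x hx
      have hx' : 0 < ‖x‖ := norm_pos_iff.2 hx
      rw [norm_norm, norm_inv, norm_pow, norm_norm, ← div_eq_mul_inv, le_div_iff₀ (by positivity)]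
      exact hC x hx
    have h2 := h1.mul_isLittleO ((ho (k - i) (by omega)).mono (nhdsWithin_le_nhds (s := {0}ᶜ)))
    refine h2.congr' (EventuallyEq.refl _ _) ?_
    filter_upwards [self_mem_nhdsWithin] with x hx
    have hx' : ‖x‖ ≠ 0 := norm_ne_zero_iff.2 hx
    have : n - (k - i) = i + (n - k) := by omega
    rw [this, pow_add, ← mul_assoc, inv_mul_cancel₀ (pow_ne_zero _ hx'), one_mul]
end

open Classical in
theorem stmt2 (p : ℕ) (hp : 1 ≤ p) (a₀ : ℝ) (ha₀ : 0 < a₀) (n : ℕ)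
    (f : EuclideanSpace ℝ (Fin p) → ℝ) (fbar : ℝ → ℝ)
    (hrad : ∀ x ∈ Metric.ball (0 : EuclideanSpace ℝ (Fin p)) a₀, f x = fbar ‖x‖)
    (hf : ContDiffOn ℝ n f (Metric.ball (0 : EuclideanSpace ℝ (Fin p)) a₀))
    (ho : ∀ ε > 0, ∃ δ > 0, ∀ x ∈ Metric.ball (0 : EuclideanSpace ℝ (Fin p)) a₀,
      0 < ‖x‖ → ‖x‖ < δ → |f x| ≤ ε * ‖x‖ ^ n)
    (i : Fin p) :
    ContDiffOn ℝ n (fun x => if x = 0 then 0 else (x i / ‖x‖) * f x)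
      (Metric.ball (0 : EuclideanSpace ℝ (Fin p)) a₀) ∧
    (∀ ε > 0, ∃ δ > 0, ∀ x ∈ Metric.ball (0 : EuclideanSpace ℝ (Fin p)) a₀,
      0 < ‖x‖ → ‖x‖ < δ →
        |if x = 0 then 0 else (x i / ‖x‖) * f x| ≤ ε * ‖x‖ ^ n) := by
  have hfun : (fun x : EuclideanSpace ℝ (Fin p) => if x = 0 then 0 else (x i / ‖x‖) * f x) =
      fun x => (x i / ‖x‖) * f x := by
    funext x
    by_cases hx : x = 0 <;> simp [hx]
  constructor
  · rw [hfun]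
    haveI : Nonempty (Fin p) := ⟨i⟩
    have ho' : f =o[𝓝[≠] 0] fun x => ‖x‖ ^ n := by
      rw [isLittleO_iff]
      intro c hc
      obtain ⟨δ, hδ, h⟩ := ho c hc
      rw [eventually_nhdsWithin_iff]
      filter_upwards [Metric.ball_mem_nhds 0 hδ, Metric.ball_mem_nhds 0 ha₀] with x h1 h2 hx
      rw [Real.norm_eq_abs, norm_pow, norm_norm]
      exact h x h2 (norm_pos_iff.2 hx) (by simpa using h1)
    have hcont : ContinuousAt f 0 :=
      hf.continuousOn.continuousAt (Metric.ball_mem_nhds 0 ha₀)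
    have f0 : f 0 = 0 := by
      have h1 : Tendsto f (𝓝[≠] 0) (𝓝 (f 0)) := hcont.tendsto.mono_left nhdsWithin_le_nhds
      have h2 : Tendsto f (𝓝[≠] 0) (𝓝 0) := by
        rw [← isLittleO_one_iff ℝ]
        refine ho'.trans_isBigO ?_
        have : Tendsto (fun x : EuclideanSpace ℝ (Fin p) => ‖x‖ ^ n) (𝓝[≠] 0)
            (𝓝 (‖(0 : EuclideanSpace ℝ (Fin p))‖ ^ n)) :=
          ((continuous_norm.pow n).tendsto 0).mono_left nhdsWithin_le_nhds
        exact this.isBigO_one ℝ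
      exact tendsto_nhds_unique h1 h2
    have ho0 : f =o[𝓝 0] fun x => ‖x‖ ^ n := by
      rw [isLittleO_iff]
      intro c hc
      have := ho'.def hc
      rw [eventually_nhdsWithin_iff] at this
      filter_upwards [this] with x hx
      by_cases hx0 : x = 0
      · rw [hx0, f0, norm_zero]; positivity
      · exact hx hx0
    have hz : ∀ k ≤ n, iteratedFDeriv ℝ k f 0 = 0 := by
      intro k hk
      refine iteratedFDeriv_zero_of_isLittleO ha₀ f (hf.of_le (by exact_mod_cast hk)) ?_
      refine ho0.trans_isBigO (IsBigO.of_bound 1 ?_)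
      filter_upwards [Metric.ball_mem_nhds 0 one_pos] with x hx
      have hx1 : ‖x‖ < 1 := by simpa using hx
      rw [norm_pow, norm_pow, norm_norm, one_mul]
      exact pow_le_pow_of_le_one (norm_nonneg _) hx1.le hk
    have hg : ∀ m : ℕ, ContDiffOn ℝ m
        (fun x : EuclideanSpace ℝ (Fin p) => x i / ‖x‖) {0}ᶜ := by
      intro m x hx
      have hx' : x ≠ 0 := hx
      refine ContDiffAt.contDiffWithinAt (ContDiffAt.div ?_ (contDiffAt_norm ℝ hx')
        (norm_ne_zero_iff.2 hx'))
      fun_prop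
    have hh : ∀ (t : ℝ) (x : EuclideanSpace ℝ (Fin p)), 0 < t →
        (t • x) i / ‖t • x‖ = x i / ‖x‖ := by
      intro t x ht
      rw [norm_smul, Real.norm_of_nonneg ht.le, PiLp.smul_apply, smul_eq_mul,
        mul_div_mul_left _ _ ht.ne']
    refine contDiffOn_of_punctured ha₀ n _ (by simp)
      (((hg n).mono fun y hy => hy.2).mul (hf.mono Set.sdiff_subset)) ?_
    exact prod_isLittleO n _ f hg hh ha₀ hf (iter_isLittleO ha₀ n f hf hz)
  · intro ε hε
    obtain ⟨δ, hδ, h⟩ := ho ε hε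
    refine ⟨δ, hδ, fun x hx h1 h2 => ?_⟩
    have h3 := h x hx h1 h2
    rw [if_neg (norm_pos_iff.1 h1), abs_mul]
    refine le_trans (mul_le_of_le_one_left (abs_nonneg _) ?_) h3
    rw [abs_div, abs_norm, div_le_one h1]
    simpa using PiLp.norm_apply_le x i
end

section
/- Let f : V → ℝ be C^l with l ≥ 1 and f ∈ 𝐨(ρ^l). Then ∂^α f(a) = 0 for every point a ∈ A and every multiindex α with |α| ≤ l. Consequently, writing x = (u,w) ∈ ℝ^p × ℝ^q, one has f(x) = Σ_{|α_u| = l} R_{α_u}(x)·x^{α_u}, where R_{α_u}(x) := (|α_u|/α_u!) ∫₀¹ (1−t)^{|α_u|−1} (∂^{α_u} f)(tu, w) dt is continuous on V and vanishes at every point of A. -/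
noncomputable section

/-- Iterated directional derivative along a list of directions. -/
def pderivList {E : Type} [NormedAddCommGroup E] [NormedSpace ℝ E] :
    List E → (E → ℝ) → E → ℝ
  | [], f => f
  | v :: vs, f => fun x => fderiv ℝ (pderivList vs f) x v

/-- The coordinate directions of `ℝ^p × ℝ^q`. -/
def basisPQ (p qd : ℕ) :
    Fin p ⊕ Fin qd → EuclideanSpace ℝ (Fin p) × EuclideanSpace ℝ (Fin qd)
  | Sum.inl i => (EuclideanSpace.single i 1, 0)
  | Sum.inr j => (0, EuclideanSpace.single j 1)

/-- The list of directions in the first factor associated to a multiindex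
`α : Fin p → ℕ` (`αᵢ` copies of the `i`-th direction). -/
def multiList (p qd : ℕ) (α : Fin p → ℕ) :
    List (EuclideanSpace ℝ (Fin p) × EuclideanSpace ℝ (Fin qd)) :=
  (List.finRange p).foldr
    (fun i acc => List.replicate (α i) (basisPQ p qd (Sum.inl i)) ++ acc) []

/-- The multiindex derivative `∂^{α_u} f`. -/
def pderivMulti (p qd : ℕ) (α : Fin p → ℕ)
    (f : EuclideanSpace ℝ (Fin p) × EuclideanSpace ℝ (Fin qd) → ℝ) :
    EuclideanSpace ℝ (Fin p) × EuclideanSpace ℝ (Fin qd) → ℝ :=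
  pderivList (multiList p qd α) f

/-- The Taylor remainder
`R_{α_u}(x) = (|α_u|/α_u!) ∫₀¹ (1−t)^{|α_u|−1} (∂^{α_u} f)(t·u, w) dt`. -/
def Rrem (p qd l : ℕ) (f : EuclideanSpace ℝ (Fin p) × EuclideanSpace ℝ (Fin qd) → ℝ)
    (α : Fin p → ℕ) (x : EuclideanSpace ℝ (Fin p) × EuclideanSpace ℝ (Fin qd)) : ℝ :=
  ((l : ℝ) / ∏ i, (Nat.factorial (α i) : ℝ)) *
    ∫ t in (0:ℝ)..1, (1 - t) ^ (l - 1) * pderivMulti p qd α f (t • x.1, x.2)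

open Set Filter Topology

section General
variable {E : Type} [NormedAddCommGroup E] [NormedSpace ℝ E]

theorem pderivList_contDiffOn {V : Set E} (hV : IsOpen V) {f : E → ℝ} {l : ℕ}
    (hf : ContDiffOn ℝ l f V) (L : List E) : ∀ m : ℕ, m + L.length ≤ l →
    ContDiffOn ℝ m (pderivList L f) V := by
  induction L with
  | nil => 
    intro m hm
    exact hf.of_le (by simpa using hm)
  | cons v vs ih =>
    intro m hm
    have h := ih (m + 1) (by simp at hm; omega)
    have h2 : ContDiffOn ℝ m (fderiv ℝ (pderivList vs f)) V :=
      h.fderiv_of_isOpen hV (by norm_cast)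
    exact h2.clm_apply contDiffOn_const

theorem pderivList_perm {V : Set E} (hV : IsOpen V) {f : E → ℝ} {l : ℕ}
    (hf : ContDiffOn ℝ l f V) {L L' : List E} (h : L.Perm L') : L.length ≤ l → 
    ∀ x ∈ V, pderivList L f x = pderivList L' f x := by
  induction h with
  | nil => intros; rfl
  | @cons a L L' h ih =>
    intro hl x hx
    have : pderivList L f =ᶠ[𝓝 x] pderivList L' f := by
      filter_upwards [hV.mem_nhds hx] with y hy
      exact ih (by simp at hl; omega) y hy
    simp only [pderivList]
    rw [this.fderiv_eq]
  | @swap a b L =>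
    intro hl x hx
    have h2 : ContDiffAt ℝ 2 (pderivList L f) x := by
      have := pderivList_contDiffOn hV hf L 2 (by simp at hl; omega)
      exact this.contDiffAt (hV.mem_nhds hx)
    have hs : IsSymmSndFDerivAt ℝ (pderivList L f) x := h2.isSymmSndFDerivAt (by simp)
    have hd : DifferentiableAt ℝ (fderiv ℝ (pderivList L f)) x :=
      (h2.fderiv_right (m := 1) (by norm_num)).differentiableAt (by norm_num)
    have key : ∀ c d : E, fderiv ℝ (fun y => fderiv ℝ (pderivList L f) y c) x d
        = fderiv ℝ (fderiv ℝ (pderivList L f)) x d c := by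
      intro c d
      rw [fderiv_clm_apply hd (differentiableAt_const c)]
      simp
    simp only [pderivList]
    rw [key, key]
    exact hs _ _
  | trans h1 h2 ih1 ih2 =>
    intro hl x hx
    rw [ih1 hl x hx, ih2 (by rw [← h1.length_eq]; exact hl) x hx]

theorem iteratedFDeriv_eq_pderivList {V : Set E} (hV : IsOpen V) {f : E → ℝ} {l : ℕ}
    (hf : ContDiffOn ℝ l f V) (n : ℕ) : ∀ (v : Fin n → E), n ≤ l → 
    ∀ x ∈ V, iteratedFDeriv ℝ n f x v = pderivList (List.ofFn v) f x := by
  induction n with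
  | zero => intro v _ x _; simp [pderivList]
  | succ n ih =>
    intro v hn x hx
    have hd : DifferentiableAt ℝ (iteratedFDeriv ℝ n f) x :=
      (hf.contDiffAt (hV.mem_nhds hx)).differentiableAt_iteratedFDeriv (by exact_mod_cast hn)
    rw [hd.iteratedFDeriv_succ_apply_left', List.ofFn_succ]
    simp only [pderivList]
    have : (fun y => iteratedFDeriv ℝ n f y (Fin.tail v)) =ᶠ[𝓝 x]
        pderivList (List.ofFn fun i : Fin n => v i.succ) f := by
      filter_upwards [hV.mem_nhds hx] with y hy
      exact ih _ (by omega) y hy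
    rw [this.fderiv_eq]

theorem iteratedFDeriv_symm {V : Set E} (hV : IsOpen V) {f : E → ℝ} {l : ℕ}
    (hf : ContDiffOn ℝ l f V) {n : ℕ} (v : Fin n → E) (hn : n ≤ l) {x : E} (hx : x ∈ V)
    (σ : Equiv.Perm (Fin n)) :
    iteratedFDeriv ℝ n f x (fun i => v (σ i)) = iteratedFDeriv ℝ n f x v := by
  rw [iteratedFDeriv_eq_pderivList hV hf n _ hn x hx, iteratedFDeriv_eq_pderivList hV hf n _ hn x hx]
  exact pderivList_perm hV hf (Equiv.Perm.ofFn_comp_perm σ v) (by simpa using hn) x hx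

theorem iteratedFDeriv_eq_zero_of_diag {V : Set E} (hV : IsOpen V) {f : E → ℝ} {l : ℕ}
    (hf : ContDiffOn ℝ l f V) {n : ℕ} (hn : n ≤ l) {x : E} (hx : x ∈ V)
    (h0 : ∀ v : E, iteratedFDeriv ℝ n f x (fun _ => v) = 0) (v : Fin n → E) :
    iteratedFDeriv ℝ n f x v = 0 := by
  have h := (iteratedFDeriv ℝ n f x).iteratedFDeriv_comp_diagonal 0 v
  have e : (fun v : E => iteratedFDeriv ℝ n f x (fun _ => v)) = fun _ => (0:ℝ) := funext h0
  rw [e] at h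
  simp only [iteratedFDeriv_symm hV hf v hn hx] at h
  simp at h
  simpa [Nat.factorial_ne_zero] using h

theorem continuousOn_parametric {X : Type*} [TopologicalSpace X] [FirstCountableTopology X] 
    {U : Set X} {F : X → ℝ → ℝ}
    (hF : ContinuousOn (fun z : X × ℝ => F z.1 z.2) (U ×ˢ Icc (0:ℝ) 1)) :
    ContinuousOn (fun x => ∫ t in (0:ℝ)..1, F x t) U := by
  rw [continuousOn_iff_continuous_domRestrict]
  have hc : Continuous (Function.uncurry fun (x : U) (t : ℝ) =>
      F x.1 (projIcc (0:ℝ) 1 zero_le_one t).1) := by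
    refine hF.comp_continuous (f := fun z : U × ℝ => (z.1.1, (projIcc (0:ℝ) 1 zero_le_one z.2).1)) ?_ ?_
    · exact (continuous_subtype_val.comp continuous_fst).prodMk 
        (continuous_subtype_val.comp (continuous_projIcc.comp continuous_snd))
    · intro z
      exact ⟨z.1.2, (projIcc (0:ℝ) 1 zero_le_one z.2).2⟩
  convert intervalIntegral.continuous_parametric_intervalIntegral_of_continuous'
    (μ := MeasureTheory.volume) hc 0 1 using 1
  funext x
  simp only [domRestrict_apply]
  apply intervalIntegral.integral_congr
  intro t ht
  rw [uIcc_of_le zero_le_one] at ht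
  simp [projIcc_of_mem _ ht]

theorem taylor_diag_zero {V : Set E} (hV : IsOpen V) {f : E → ℝ} {l : ℕ}
    (hf : ContDiffOn ℝ l f V) {a : E} (ha : a ∈ V)
    (ho : ∀ ε > 0, ∃ δ > 0, ∀ x ∈ V, ‖x - a‖ < δ → |f x| ≤ ε * ‖x - a‖ ^ l) (v : E) (k : ℕ) :
    k ≤ l → iteratedFDeriv ℝ k f a (fun _ => v) = 0 := by
  induction k using Nat.strong_induction_on with
  | _ k ih =>
  intro hk
  by_cases hl0 : k = 0
  · subst hl0
    simp only [iteratedFDeriv_zero_apply]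
    by_contra hne
    have hpos : 0 < |f a| := abs_pos.mpr hne
    obtain ⟨δ, hδ, h⟩ := ho (|f a| / 2) (by positivity)
    have := h a ha (by simpa using hδ)
    rcases Nat.eq_zero_or_pos l with h0 | h0
    · subst h0; simp at this; linarith
    · simp [h0.ne'] at this; exact hne this
  obtain ⟨n, rfl⟩ := Nat.exists_eq_succ_of_ne_zero hl0
  obtain ⟨r, hr, hrV⟩ := Metric.isOpen_iff.mp hV a ha
  set U : Set ℝ := {t | ‖t • v‖ < r} with hU
  have hUo : IsOpen U := isOpen_lt (by fun_prop) (by fun_prop)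
  have h0U : (0:ℝ) ∈ U := by simp [hU, hr]
  have hmem : ∀ t ∈ U, ∀ s ∈ Icc (0:ℝ) 1, a + s • t • v ∈ V := by
    intro t ht s hs
    apply hrV
    rw [Metric.mem_ball, dist_eq_norm, add_sub_cancel_left, norm_smul, Real.norm_eq_abs,
      abs_of_nonneg hs.1]
    have : ‖t • v‖ < r := ht
    nlinarith [hs.2, norm_nonneg (t • v)]
  have hcd : ContinuousOn (iteratedFDeriv ℝ (n+1) f) V := fun x hx =>
    ((hf.contDiffAt (hV.mem_nhds hx)).continuousAt_iteratedFDeriv 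
      (by exact_mod_cast hk)).continuousWithinAt
  set I : ℝ → ℝ := fun t => ∫ s in (0:ℝ)..1, (1 - s) ^ n *
    iteratedFDeriv ℝ (n+1) f (a + s • t • v) (fun _ => v) with hI
  have hIc : ContinuousOn I U := by
    apply continuousOn_parametric
    refine ContinuousOn.mul (by fun_prop) ?_
    have h1 : ContinuousOn (fun z : ℝ × ℝ => iteratedFDeriv ℝ (n+1) f (a + z.2 • z.1 • v))
        (U ×ˢ Icc (0:ℝ) 1) :=
      hcd.comp (by fun_prop) (fun z hz => hmem _ hz.1 _ hz.2)
    exact (ContinuousMultilinearMap.apply ℝ (fun _ : Fin (n+1) => E) ℝ 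
      (fun _ => v)).continuous.comp_continuousOn h1
  have hI0 : I 0 = (1 / (n + 1)) * iteratedFDeriv ℝ (n+1) f a (fun _ => v) := by
    simp only [hI, zero_smul, smul_zero, add_zero]
    rw [intervalIntegral.integral_mul_const]
    congr 1
    rw [intervalIntegral.integral_comp_sub_left (fun s => s ^ n) 1]
    simp
  have hT : ∀ t ∈ U, f (a + t • v) = (n.factorial : ℝ)⁻¹ * (t ^ (n+1) * I t) := by
    intro t ht
    have := map_add_eq_sum_add_integral_iteratedFDeriv (f := f) (x := a) (y := t • v) (n := n)
      (fun s hs => (hf.contDiffAt (hV.mem_nhds (hmem t ht s hs))).of_le (by exact_mod_cast hk))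
    have hsm : ∀ (m : ℕ) (z : E), iteratedFDeriv ℝ m f z (fun _ => t • v) 
        = t ^ m * iteratedFDeriv ℝ m f z (fun _ => v) := by
      intro m z
      have := (iteratedFDeriv ℝ m f z).map_smul_univ (fun _ => t) (fun _ => v)
      simpa using this
    rw [this, Finset.sum_eq_zero, zero_add, smul_eq_mul]
    · congr 1
      rw [hI, ← intervalIntegral.integral_const_mul]
      congr 1
      funext s
      rw [hsm, smul_eq_mul]; ring
    · intro j hj
      rw [Finset.mem_range] at hj
      rw [hsm, ih j (by omega) (by omega)]; simp
  have hz : I 0 = 0 := by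
    by_contra hne
    have hpos : 0 < |I 0| := abs_pos.mpr hne
    have hCat : ContinuousAt I 0 := hIc.continuousAt (hUo.mem_nhds h0U)
    have hev1 : ∀ᶠ t in 𝓝 (0:ℝ), |I 0| / 2 < |I t| :=
      hCat.abs.eventually (lt_mem_nhds (by linarith))
    have hfp : (0:ℝ) < n.factorial := by exact_mod_cast n.factorial_pos
    set ε := |I 0| / (4 * n.factorial * (‖v‖ ^ l + 1)) with hε
    obtain ⟨δ, hδ, h⟩ := ho ε (by positivity)
    have hev2 : ∀ᶠ t in 𝓝 (0:ℝ), ‖t • v‖ < δ := by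
      have : ContinuousAt (fun t : ℝ => ‖t • v‖) 0 := by fun_prop
      exact this.eventually (gt_mem_nhds (by simpa using hδ))
    have hev3 : ∀ᶠ t in 𝓝 (0:ℝ), |t| < 1 := by
      have : ContinuousAt (fun t : ℝ => |t|) 0 := by fun_prop
      exact this.eventually (gt_mem_nhds (by simp))
    have hall := (hev1.and (hev2.and (hev3.and (hUo.mem_nhds h0U))))
    obtain ⟨t, ⟨h1, h2, h3, h4⟩, htpos⟩ :=
      ((hall.filter_mono nhdsWithin_le_nhds).and (self_mem_nhdsWithin (s := Ioi (0:ℝ)))).exists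
    have htpos : 0 < t := htpos
    have hV' : a + t • v ∈ V := by simpa using hmem t h4 1 (by simp)
    have hb := h _ hV' (by simpa using h2)
    rw [hT t h4, add_sub_cancel_left, norm_smul, mul_pow, Real.norm_eq_abs, abs_of_pos htpos,
      abs_mul, abs_mul, abs_of_pos (inv_pos.mpr hfp), abs_of_pos (pow_pos htpos _)] at hb
    rw [abs_of_pos htpos] at h3
    have hp1 : t ^ l ≤ t ^ (n+1) := pow_le_pow_of_le_one htpos.le h3.le hk
    have hp2 : 0 < t ^ (n+1) := by positivity
    have hv : 0 ≤ ‖v‖ ^ l := by positivity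
    have hb2 : (n.factorial : ℝ)⁻¹ * (t ^ (n+1) * |I t|) ≤ ε * (t ^ (n+1) * (‖v‖ ^ l + 1)) := by
      refine hb.trans ?_
      have : 0 < ε := by positivity
      gcongr
      linarith
    have e1 : ε * (t ^ (n+1) * (‖v‖ ^ l + 1)) = (n.factorial : ℝ)⁻¹ * (t ^ (n+1) * (|I 0| / 4)) := by
      rw [hε]; field_simp
    rw [e1] at hb2
    have := le_of_mul_le_mul_left (le_of_mul_le_mul_left hb2 (inv_pos.mpr hfp)) hp2
    linarith
  rw [hI0] at hz
  have : (1 / ((n:ℝ) + 1)) ≠ 0 := by positivity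
  exact (mul_eq_zero.mp hz).resolve_left this

end General

section Multinomial

theorem prod_monomial {p : ℕ} {ι : Type*} (s : Finset ι) (m : ι → (Fin p →₀ ℕ)) (c : ι → ℝ) :
    ∏ j ∈ s, MvPolynomial.monomial (m j) (c j) =
      MvPolynomial.monomial (∑ j ∈ s, m j) (∏ j ∈ s, c j) := by
  classical
  induction s using Finset.induction_on with
  | empty => simp
  | insert a s ha ih =>
    rw [Finset.prod_insert ha, Finset.sum_insert ha, Finset.prod_insert ha, ih,
      MvPolynomial.monomial_mul]

theorem multinomial_sum {p l : ℕ} (u : Fin p → ℝ) (g : (Fin p → ℕ) → ℝ) :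
    ∑ r : Fin l → Fin p, (∏ j, u (r j)) * g (fun i => ∑ j, if r j = i then 1 else 0) =
    ∑ α ∈ Finset.Nat.antidiagonalTuple p l,
      ((l.factorial : ℝ) / ∏ i, ((α i).factorial : ℝ)) * (∏ i, u i ^ α i) * g α := by
  classical
  set Λ : MvPolynomial (Fin p) ℝ →ₗ[ℝ] ℝ :=
    (MvPolynomial.basisMonomials (Fin p) ℝ).constr ℝ (fun m => g m) with hΛ
  have hm : ∀ (m : Fin p →₀ ℕ) (c : ℝ), Λ (MvPolynomial.monomial m c) = c * g m := by
    intro m c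
    have h1 : MvPolynomial.monomial m c = c • MvPolynomial.basisMonomials (Fin p) ℝ m := by
      simp [MvPolynomial.smul_monomial]
    rw [h1, map_smul, hΛ, Module.Basis.constr_basis, smul_eq_mul]
  set P : MvPolynomial (Fin p) ℝ := 
    ∑ i, MvPolynomial.monomial (Finsupp.single i 1) (u i) with hP
  have e1 : P ^ l = ∑ r : Fin l → Fin p, MvPolynomial.monomial 
      (∑ j, Finsupp.single (r j) 1) (∏ j, u (r j)) := by
    have : P ^ l = ∏ _j : Fin l, P := by simp
    rw [this, hP, Finset.prod_univ_sum]
    simp only [Fintype.piFinset_univ]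
    exact Finset.sum_congr rfl fun r _ => prod_monomial _ _ _
  have e2 := Finset.sum_pow_eq_sum_piAntidiag Finset.univ 
    (fun i => MvPolynomial.monomial (Finsupp.single i 1) (u i)) l
  rw [← hP, e1] at e2
  have e3 := congrArg Λ e2
  rw [map_sum, map_sum] at e3
  have hset : Finset.piAntidiag (Finset.univ : Finset (Fin p)) l 
      = Finset.Nat.antidiagonalTuple p l := by
    ext α
    simp [Finset.Nat.mem_antidiagonalTuple]
  rw [hset] at e3
  convert e3 using 1
  · refine Finset.sum_congr rfl fun r _ => ?_
    rw [hm]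
    congr 2
    funext i
    simp [Finsupp.finsetSum_apply, Finsupp.single_apply]
  · refine Finset.sum_congr rfl fun α hα => ?_
    have hα' : ∑ i, α i = l := Finset.Nat.mem_antidiagonalTuple.mp hα
    simp only [MvPolynomial.monomial_pow]
    rw [prod_monomial, ← nsmul_eq_mul, map_nsmul, hm, nsmul_eq_mul, ← mul_assoc]
    congr 1
    · congr 1
      have := Nat.multinomial_spec Finset.univ α
      rw [hα'] at this
      have h2 : (∏ i, ((α i).factorial : ℝ)) * (Nat.multinomial Finset.univ α : ℝ) 
          = (l.factorial : ℝ) := by exact_mod_cast this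
      have h3 : (∏ i, ((α i).factorial : ℝ)) ≠ 0 :=
        Finset.prod_ne_zero_iff.mpr fun i _ => by exact_mod_cast (α i).factorial_ne_zero
      rw [← h2]; field_simp
    · congr 1
      funext i
      simp [Finsupp.finsetSum_apply, Finsupp.single_apply]

/-- The list of indices underlying `multiList`. -/
def idxList (p : ℕ) (α : Fin p → ℕ) (K : List (Fin p)) : List (Fin p) :=
  K.foldr (fun i acc => List.replicate (α i) i ++ acc) []

theorem idxList_count (p : ℕ) (α : Fin p → ℕ) (K : List (Fin p)) (i : Fin p) :
    (idxList p α K).count i = K.count i * α i := by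
  induction K with
  | nil => simp [idxList]
  | cons a K ih =>
    have : idxList p α (a :: K) = List.replicate (α a) a ++ idxList p α K := rfl
    rw [this, List.count_append, ih, List.count_replicate, List.count_cons]
    by_cases h : a = i
    · subst h; simp; ring
    · simp [h]

theorem multiList_eq (p qd : ℕ) (α : Fin p → ℕ) :
    multiList p qd α = (idxList p α (List.finRange p)).map (fun i => basisPQ p qd (Sum.inl i)) := by
  unfold multiList
  generalize List.finRange p = K
  induction K with
  | nil => simp [idxList]
  | cons a K ih =>
    have : idxList p α (a :: K) = List.replicate (α a) a ++ idxList p α K := rfl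
    rw [this, List.map_append, List.foldr_cons, ih]
    simp

theorem count_ofFn' {p l : ℕ} (r : Fin l → Fin p) (i : Fin p) :
    (List.ofFn r).count i = ∑ j, if r j = i then 1 else 0 := by
  induction l with
  | zero => simp
  | succ l ih =>
    rw [List.ofFn_succ, List.count_cons, ih, Fin.sum_univ_succ, add_comm]
    simp

theorem multiList_perm (p qd : ℕ) {l : ℕ} (r : Fin l → Fin p) :
    (List.ofFn (fun j => basisPQ p qd (Sum.inl (r j)))).Perm
      (multiList p qd (fun i => ∑ j, if r j = i then 1 else 0)) := by
  have : List.ofFn (fun j => basisPQ p qd (Sum.inl (r j))) =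
      (List.ofFn r).map (fun i => basisPQ p qd (Sum.inl i)) := by
    rw [List.map_ofFn]; rfl
  rw [this, multiList_eq]
  apply List.Perm.map
  rw [List.perm_iff_count]
  intro i
  rw [idxList_count, count_ofFn',
    List.count_eq_one_of_mem (List.nodup_finRange p) (List.mem_finRange i), one_mul]

theorem multiList_length (p qd : ℕ) (α : Fin p → ℕ) : (multiList p qd α).length = ∑ i, α i := by
  unfold multiList
  rw [← List.sum_ofFn, List.ofFn_eq_map]
  generalize List.finRange p = K
  induction K with
  | nil => simp
  | cons a K ih =>
    rw [List.foldr_cons, List.length_append, ih]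
    simp

theorem multiList_mem (p qd : ℕ) (α : Fin p → ℕ) :
    multiList p qd α = 
      ((idxList p α (List.finRange p)).map Sum.inl).map (basisPQ p qd) := by
  rw [multiList_eq, List.map_map]; rfl

theorem iteratedFDeriv_multi (p qd l : ℕ)
    {V : Set (EuclideanSpace ℝ (Fin p) × EuclideanSpace ℝ (Fin qd))} (hV : IsOpen V)
    {f : EuclideanSpace ℝ (Fin p) × EuclideanSpace ℝ (Fin qd) → ℝ}
    (hf : ContDiffOn ℝ l f V) (u : EuclideanSpace ℝ (Fin p)) 
    {z : EuclideanSpace ℝ (Fin p) × EuclideanSpace ℝ (Fin qd)} (hz : z ∈ V) :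
    iteratedFDeriv ℝ l f z (fun _ => (u, 0)) = 
    ∑ α ∈ Finset.Nat.antidiagonalTuple p l,
      ((l.factorial : ℝ) / ∏ i, ((α i).factorial : ℝ)) * (∏ i, u i ^ α i) * 
        pderivMulti p qd α f z := by
  classical
  have hu : ((u, 0) : EuclideanSpace ℝ (Fin p) × EuclideanSpace ℝ (Fin qd)) = 
      ∑ i, u i • basisPQ p qd (Sum.inl i) := by
    simp only [basisPQ, Prod.smul_mk, smul_zero]
    ext j
    · simp [Prod.fst_sum, Pi.single_apply]
    · simp [Prod.snd_sum]
  rw [hu, ← multinomial_sum (fun i => u i) (fun α => pderivMulti p qd α f z)]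
  rw [ContinuousMultilinearMap.map_sum]
  refine Finset.sum_congr rfl fun r _ => ?_
  rw [ContinuousMultilinearMap.map_smul_univ, smul_eq_mul,
    iteratedFDeriv_eq_pderivList hV hf l _ le_rfl z hz,
    pderivList_perm hV hf (multiList_perm p qd r) (by simp) z hz]
  rfl

end Multinomial

/- **Statement 3** (Taylor lemma).
Let `f : V → ℝ` be `C^l` (`l ≥ 1`) and `f ∈ 𝐨(ρ^l)` on `V = B^p × V^q`.  Then
`∂^α f(a) = 0` for every `a` on the axis and every multiindex `α` with
`|α| ≤ l`, and `f(x) = Σ_{|α_u| = l} R_{α_u}(x) x^{α_u}`, where each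
`R_{α_u}` (given by the explicit integral formula) is continuous on `V` and
vanishes on the axis. -/
theorem stmt3 (p qd : ℕ) (hp : 1 ≤ p) (l : ℕ) (hl : 1 ≤ l)
    (a₀ : ℝ) (ha₀ : 0 < a₀)
    (Vq : Set (EuclideanSpace ℝ (Fin qd))) (hVq : IsOpen Vq) (hVqc : IsConnected Vq)
    (V : Set (EuclideanSpace ℝ (Fin p) × EuclideanSpace ℝ (Fin qd)))
    (hV : V = (Metric.ball (0 : EuclideanSpace ℝ (Fin p)) a₀) ×ˢ Vq)
    (f : EuclideanSpace ℝ (Fin p) × EuclideanSpace ℝ (Fin qd) → ℝ)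
    (hf : ContDiffOn ℝ l f V)
    (ho : ∀ ε > 0, ∃ δ > 0, ∀ x ∈ V, 0 < ‖x.1‖ → ‖x.1‖ < δ → |f x| ≤ ε * ‖x.1‖ ^ l) :
    (∀ L : List (Fin p ⊕ Fin qd), L.length ≤ l →
      ∀ a ∈ V, a.1 = 0 → pderivList (L.map (basisPQ p qd)) f a = 0) ∧
    (∀ x ∈ V,
      f x = ∑ α ∈ Finset.Nat.antidiagonalTuple p l,
        Rrem p qd l f α x * ∏ i, (x.1 i) ^ (α i)) ∧
    (∀ α ∈ Finset.Nat.antidiagonalTuple p l,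
      ContinuousOn (Rrem p qd l f α) V ∧
      ∀ a ∈ V, a.1 = 0 → Rrem p qd l f α a = 0) := by
  have hVo : IsOpen V := hV ▸ Metric.isOpen_ball.prod hVq
  -- the segment to the axis stays in `V`
  have hseg : ∀ x ∈ V, ∀ t ∈ Icc (0:ℝ) 1, (t • x.1, x.2) ∈ V := by
    intro x hx t ht
    rw [hV] at hx ⊢
    refine ⟨?_, hx.2⟩
    have h1 : ‖x.1‖ < a₀ := by simpa using hx.1
    rw [mem_ball_zero_iff, norm_smul, Real.norm_eq_abs, abs_of_nonneg ht.1]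
    nlinarith [ht.2, norm_nonneg x.1]
  -- `f` vanishes on the axis
  have hzero : ∀ a ∈ V, a.1 = 0 → f a = 0 := by
    intro a ha ha1
    have hcont : ContinuousAt f a := hf.continuousOn.continuousAt (hVo.mem_nhds ha)
    let e : EuclideanSpace ℝ (Fin p) × EuclideanSpace ℝ (Fin qd) :=
      (EuclideanSpace.single ⟨0, hp⟩ 1, 0)
    have hc : ContinuousAt (fun s : ℝ => a + s • e) 0 := by fun_prop
    have hc0 : (fun s : ℝ => a + s • e) 0 = a := by simp
    have hfc : ContinuousAt (fun s : ℝ => |f (a + s • e)|) 0 := by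
      have : ContinuousAt f ((fun s : ℝ => a + s • e) 0) := by rw [hc0]; exact hcont
      exact (ContinuousAt.comp (f := fun s : ℝ => a + s • e) (g := f) this hc).abs
    have hn : ∀ s : ℝ, 0 < s → ‖(a + s • e).1‖ = s := by
      intro s hs
      simp [e, ha1, norm_smul, abs_of_pos hs]
    have hlim : Tendsto (fun s : ℝ => |f (a + s • e)|) (𝓝[>] 0) (𝓝 |f a|) := by
      have := hfc.tendsto.mono_left (nhdsWithin_le_nhds (s := Ioi (0:ℝ)))
      simpa using this
    have hlim2 : Tendsto (fun s : ℝ => (1:ℝ) * s ^ l) (𝓝[>] 0) (𝓝 0) := by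
      have h : ContinuousAt (fun s : ℝ => (1:ℝ) * s ^ l) 0 := by fun_prop
      have := h.tendsto.mono_left (nhdsWithin_le_nhds (s := Ioi (0:ℝ)))
      simpa [show l ≠ 0 by omega] using this
    obtain ⟨δ, hδ, h⟩ := ho 1 one_pos
    have hmemV : ∀ᶠ s : ℝ in 𝓝[>] 0, a + s • e ∈ V := by
      have : V ∈ 𝓝 ((fun s : ℝ => a + s • e) 0) := by rw [hc0]; exact hVo.mem_nhds ha
      exact (hc.eventually this).filter_mono nhdsWithin_le_nhds
    have hle : |f a| ≤ 0 := by
      refine le_of_tendsto_of_tendsto hlim hlim2 ?_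
      filter_upwards [hmemV, Ioo_mem_nhdsGT hδ] with s hs1 hs2
      have := h _ hs1 (by rw [hn s hs2.1]; exact hs2.1) (by rw [hn s hs2.1]; exact hs2.2)
      rwa [hn s hs2.1] at this
    exact abs_eq_zero.mp (le_antisymm hle (abs_nonneg _))
  -- all derivatives vanish on the axis
  have hD : ∀ a ∈ V, a.1 = 0 → ∀ k ≤ l, ∀ v, iteratedFDeriv ℝ k f a v = 0 := by
    intro a ha ha1 k hk v
    refine iteratedFDeriv_eq_zero_of_diag hVo hf hk ha (fun w => ?_) v
    refine taylor_diag_zero hVo hf ha ?_ w k hk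
    intro ε hε
    obtain ⟨δ, hδ, h⟩ := ho ε hε
    refine ⟨δ, hδ, fun x hx hxδ => ?_⟩
    have hle : ‖x.1‖ ≤ ‖x - a‖ := by
      have := norm_fst_le (x - a)
      simpa [ha1] using this
    rcases eq_or_ne x.1 0 with h0 | h0
    · rw [hzero x hx h0, abs_zero]; positivity
    · refine (h x hx (norm_pos_iff.mpr h0) (hle.trans_lt hxδ)).trans ?_
      gcongr
  have hP : ∀ L : List (Fin p ⊕ Fin qd), L.length ≤ l →
      ∀ a ∈ V, a.1 = 0 → pderivList (L.map (basisPQ p qd)) f a = 0 := by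
    intro L hL a ha ha1
    have := iteratedFDeriv_eq_pderivList hVo hf (L.map (basisPQ p qd)).length
      (L.map (basisPQ p qd)).get (by simpa using hL) a ha
    rw [List.ofFn_get] at this
    rw [← this]
    exact hD a ha ha1 _ (by simpa using hL) _
  have hlen : ∀ α ∈ Finset.Nat.antidiagonalTuple p l, (multiList p qd α).length = l := by
    intro α hα
    rw [multiList_length]
    exact Finset.Nat.mem_antidiagonalTuple.mp hα
  have hcontP : ∀ α ∈ Finset.Nat.antidiagonalTuple p l,
      ContinuousOn (pderivMulti p qd α f) V := by
    intro α hα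
    exact (pderivList_contDiffOn hVo hf (multiList p qd α) 0 (by rw [hlen α hα]; omega)).continuousOn
  have hcontF : ∀ α ∈ Finset.Nat.antidiagonalTuple p l,
      ContinuousOn (fun z : (EuclideanSpace ℝ (Fin p) × EuclideanSpace ℝ (Fin qd)) × ℝ =>
        (1 - z.2) ^ (l - 1) * pderivMulti p qd α f (z.2 • z.1.1, z.1.2)) (V ×ˢ Icc (0:ℝ) 1) := by
    intro α hα
    refine ContinuousOn.mul (by fun_prop) ?_
    exact (hcontP α hα).comp (f := fun z : (EuclideanSpace ℝ (Fin p) × 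
      EuclideanSpace ℝ (Fin qd)) × ℝ => (z.2 • z.1.1, z.1.2)) (by fun_prop)
      (fun z hz => hseg _ hz.1 _ hz.2)
  refine ⟨hP, ?_, ?_⟩
  · intro x hx
    obtain ⟨n, rfl⟩ : ∃ n, l = n + 1 := ⟨l - 1, by omega⟩
    have hxe : ∀ t : ℝ, ((0, x.2) : EuclideanSpace ℝ (Fin p) × EuclideanSpace ℝ (Fin qd)) 
        + t • (x.1, 0) = (t • x.1, x.2) := by
      intro t; simp
    have hT := map_add_eq_sum_add_integral_iteratedFDeriv (f := f) 
      (x := ((0, x.2) : EuclideanSpace ℝ (Fin p) × EuclideanSpace ℝ (Fin qd)))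
      (y := (x.1, 0)) (n := n) (fun t ht => by
        rw [hxe]
        exact_mod_cast hf.contDiffAt (hVo.mem_nhds (hseg x hx t ht)))
    have hax : ((0, x.2) : EuclideanSpace ℝ (Fin p) × EuclideanSpace ℝ (Fin qd)) ∈ V := by
      simpa using hseg x hx 0 (by simp)
    have hfx : ((0, x.2) : EuclideanSpace ℝ (Fin p) × EuclideanSpace ℝ (Fin qd)) + (x.1, 0) = x := by
      simp
    rw [hfx, Finset.sum_eq_zero (fun k hk => by
      rw [hD _ hax rfl k (by rw [Finset.mem_range] at hk; omega)]; simp), zero_add] at hT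
    rw [hT]
    have hint : ∀ α ∈ Finset.Nat.antidiagonalTuple p (n+1), IntervalIntegrable (fun t : ℝ =>
        (1 - t) ^ n * pderivMulti p qd α f (t • x.1, x.2)) MeasureTheory.volume 0 1 := by
      intro α hα
      apply ContinuousOn.intervalIntegrable
      rw [uIcc_of_le zero_le_one]
      exact (hcontF α hα).comp (f := fun t : ℝ => (x, t)) (by fun_prop) (fun t ht => ⟨hx, ht⟩)
    have hcongr : ∫ t in (0:ℝ)..1, (1 - t) ^ n • iteratedFDeriv ℝ (n + 1) f 
          ((0, x.2) + t • (x.1, 0)) (fun _ => (x.1, 0)) = 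
        ∫ t in (0:ℝ)..1, ∑ α ∈ Finset.Nat.antidiagonalTuple p (n+1),
          ((((n+1).factorial : ℝ) / ∏ i, ((α i).factorial : ℝ)) * (∏ i, x.1 i ^ α i)) * 
          ((1 - t) ^ n * pderivMulti p qd α f (t • x.1, x.2)) := by
      apply intervalIntegral.integral_congr
      intro t ht
      rw [uIcc_of_le zero_le_one] at ht
      simp only []
      rw [hxe, iteratedFDeriv_multi p qd (n+1) hVo hf x.1 (hseg x hx t ht), smul_eq_mul,
        Finset.mul_sum]
      exact Finset.sum_congr rfl fun α _ => by ring
    rw [hcongr, intervalIntegral.integral_finsetSum (fun α hα => (hint α hα).const_mul _),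
      smul_eq_mul, Finset.mul_sum]
    refine Finset.sum_congr rfl fun α hα => ?_
    rw [intervalIntegral.integral_const_mul]
    unfold Rrem
    simp only [Nat.add_sub_cancel]
    have hf0 : (n.factorial : ℝ) ≠ 0 := by exact_mod_cast n.factorial_ne_zero
    rw [Nat.factorial_succ]
    push_cast
    field_simp
  · intro α hα
    refine ⟨?_, ?_⟩
    · exact continuousOn_const.mul (continuousOn_parametric (hcontF α hα))
    · intro a ha ha1
      have h0 : pderivMulti p qd α f a = 0 := by
        unfold pderivMulti
        have hl' := hlen α hα
        rw [multiList_mem] at hl' ⊢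
        exact hP _ (by rw [List.length_map] at hl'; omega) a ha ha1
      unfold Rrem
      have : ∀ t : ℝ, (t • a.1, a.2) = a := by
        intro t; rw [ha1, smul_zero, ← ha1]
      simp [this, h0]
end
end

section
/- Let l ≥ 1 and let f, g : [0,a) → ℝ (a > 0) be C^l functions with f(x) = o(x^l) and g(x) = o(x^l) as x → 0⁺. Then the function h(x) := f(x)g(x)/x, defined for x > 0, extends to a C^l function on [0,a). -/
open Set Filter Topology

/-- `u` is `n` times differentiable on `(0,a)` with `u^(j) = o(x^(r-j))` for `j ≤ n`. -/
def DD (a : ℝ) : ℕ → ℤ → (ℝ → ℝ) → Prop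
  | 0, r, u => ContinuousOn u (Ioo 0 a) ∧ Tendsto (fun x => u x / x ^ r) (𝓝[>] 0) (𝓝 0)
  | n + 1, r, u => Tendsto (fun x => u x / x ^ r) (𝓝[>] 0) (𝓝 0) ∧
      ∃ v : ℝ → ℝ, (∀ x ∈ Ioo 0 a, HasDerivAt u (v x) x) ∧ DD a n (r - 1) v

theorem DD.little {a : ℝ} {n : ℕ} {r : ℤ} {u : ℝ → ℝ} (h : DD a n r u) :
    Tendsto (fun x => u x / x ^ r) (𝓝[>] 0) (𝓝 0) := by
  cases n with
  | zero => exact h.2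
  | succ n => exact h.1

theorem DD.pred {a : ℝ} {n : ℕ} {r : ℤ} {u : ℝ → ℝ} (h : DD a (n + 1) r u) : DD a n r u := by
  induction n generalizing r u with
  | zero =>
    obtain ⟨h1, v, hv, -⟩ := h
    exact ⟨fun x hx => (hv x hx).continuousAt.continuousWithinAt, h1⟩
  | succ n ih =>
    obtain ⟨h1, v, hv, h2⟩ := h
    exact ⟨h1, v, hv, ih h2⟩

theorem DD.add {a : ℝ} {n : ℕ} {r : ℤ} {u v : ℝ → ℝ} (h : DD a n r u) (h' : DD a n r v) :
    DD a n r (fun x => u x + v x) := by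
  have hl : Tendsto (fun x => (u x + v x) / x ^ r) (𝓝[>] 0) (𝓝 0) := by
    simpa [add_div] using h.little.add h'.little
  induction n generalizing r u v with
  | zero => exact ⟨h.1.add h'.1, hl⟩
  | succ n ih =>
    obtain ⟨h1, p, hp, h2⟩ := h
    obtain ⟨h1', p', hp', h2'⟩ := h'
    refine ⟨hl, fun x => p x + p' x, fun x hx => (hp x hx).add (hp' x hx), ih h2 h2' ?_⟩
    simpa [add_div] using h2.little.add h2'.little

theorem DD.neg {a : ℝ} {n : ℕ} {r : ℤ} {u : ℝ → ℝ} (h : DD a n r u) :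
    DD a n r (fun x => - u x) := by
  have hl : Tendsto (fun x => (- u x) / x ^ r) (𝓝[>] 0) (𝓝 0) := by
    simpa [neg_div] using h.little.neg
  induction n generalizing r u with
  | zero => exact ⟨h.1.neg, hl⟩
  | succ n ih =>
    obtain ⟨h1, p, hp, h2⟩ := h
    refine ⟨hl, fun x => - p x, fun x hx => (hp x hx).neg, ih h2 ?_⟩
    simpa [neg_div] using h2.little.neg

theorem DD.mul {a : ℝ} {n : ℕ} {r s : ℤ} {u v : ℝ → ℝ} (h : DD a n r u) (h' : DD a n s v) :
    DD a n (r + s) (fun x => u x * v x) := by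
  have hl : Tendsto (fun x => (u x * v x) / x ^ (r + s)) (𝓝[>] 0) (𝓝 0) := by
    have := h.little.mul h'.little
    rw [mul_zero] at this
    refine this.congr' ?_
    filter_upwards [self_mem_nhdsWithin] with x hx
    have hx : x ≠ 0 := ne_of_gt hx
    rw [zpow_add₀ hx, div_mul_div_comm]
  induction n generalizing r s u v with
  | zero => exact ⟨h.1.mul h'.1, hl⟩
  | succ n ih =>
    have hu := h.pred
    have hv := h'.pred
    obtain ⟨h1, p, hp, h2⟩ := h
    obtain ⟨h1', p', hp', h2'⟩ := h'
    have aux : ∀ {r s : ℤ} {u v : ℝ → ℝ}, DD a n r u → DD a n s v →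
        DD a n (r + s) (fun x => u x * v x) := by
      intro r s u v h h'
      refine ih h h' ?_
      have := h.little.mul h'.little
      rw [mul_zero] at this
      refine this.congr' ?_
      filter_upwards [self_mem_nhdsWithin] with x hx
      have hx : x ≠ 0 := ne_of_gt hx
      rw [zpow_add₀ hx, div_mul_div_comm]
    refine ⟨hl, fun x => p x * v x + u x * p' x, fun x hx => (hp x hx).mul (hp' x hx), ?_⟩
    have e1 := aux h2 hv
    have e2 := aux hu h2'
    rw [show r - 1 + s = r + s - 1 by ring] at e1
    rw [show r + (s - 1) = r + s - 1 by ring] at e2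
    exact e1.add e2

theorem DD.divx {a : ℝ} {n : ℕ} {r : ℤ} {u : ℝ → ℝ} (h : DD a n r u) :
    DD a n (r - 1) (fun x => u x / x) := by
  induction n generalizing r u with
  | zero =>
    refine ⟨h.1.div continuousOn_id fun x hx => ne_of_gt hx.1, ?_⟩
    refine h.little.congr' ?_
    filter_upwards [self_mem_nhdsWithin] with x hx
    have hx : x ≠ 0 := ne_of_gt hx
    rw [zpow_sub_one₀ hx]
    field_simp
  | succ n ih =>
    have hu := h.pred
    obtain ⟨h1, p, hp, h2⟩ := h
    refine ⟨(ih hu).little, fun x => p x / x + - (u x / x / x), fun x hx => ?_,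
      (ih h2).add (ih (ih hu)).neg⟩
    have hx0 : x ≠ 0 := ne_of_gt hx.1
    refine ((hp x hx).div (hasDerivAt_id x) hx0).congr_deriv ?_
    simp only [id]
    field_simp
    ring

theorem nhds_le {a : ℝ} (ha : 0 < a) : 𝓝[>] (0:ℝ) ≤ 𝓝[Ico 0 a] 0 := by
  rw [← nhdsWithin_Ioo_eq_nhdsGT ha]
  exact nhdsWithin_mono _ Ioo_subset_Ico_self

theorem uniq {a : ℝ} (ha : 0 < a) : UniqueDiffOn ℝ (Ico 0 a) :=
  uniqueDiffOn_Ico 0 a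

theorem DD.extend {a : ℝ} (ha : 0 < a) {n : ℕ} {r : ℤ} {u : ℝ → ℝ} (h : DD a n r u)
    (hr : (n : ℤ) ≤ r) : ContDiffOn ℝ n (fun x => if x ≤ 0 then 0 else u x) (Ico 0 a) := by
  have key : ∀ (k : ℕ), (k : ℤ) ≤ r → Tendsto (fun x => u x / x ^ k) (𝓝[>] 0) (𝓝 0) := by
    intro k hk
    obtain ⟨m, rfl⟩ : ∃ m : ℕ, r = k + m := ⟨(r - k).toNat, by omega⟩
    have h0 : Tendsto (fun x : ℝ => x ^ m) (𝓝[>] 0) (𝓝 (0 ^ m)) :=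
      ((continuous_pow m).tendsto 0).mono_left nhdsWithin_le_nhds
    have := h.little.mul h0
    rw [zero_mul] at this
    refine this.congr' ?_
    filter_upwards [self_mem_nhdsWithin] with x hx
    have hx : x ≠ 0 := ne_of_gt hx
    rw [zpow_add₀ hx, zpow_natCast, zpow_natCast]
    field_simp
  have evpos : ∀ x ∈ Ioo 0 a, (fun x => if x ≤ 0 then 0 else u x) =ᶠ[𝓝 x] u := by
    intro x hx
    filter_upwards [lt_mem_nhds hx.1] with y hy
    simp [not_le.2 hy]
  induction n generalizing r u with
  | zero =>
    rw [Nat.cast_zero, contDiffOn_zero]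
    intro x hx
    rcases hx.1.eq_or_lt with rfl | hx0
    · rw [← Ioo_insert_left ha, continuousWithinAt_insert_self]
      have h1 : Tendsto u (𝓝[>] 0) (𝓝 0) := by simpa using key 0 (by simpa using hr)
      unfold ContinuousWithinAt
      rw [nhdsWithin_Ioo_eq_nhdsGT ha]
      simp only [le_refl, if_true]
      refine h1.congr' ?_
      filter_upwards [self_mem_nhdsWithin] with y hy
      simp [not_le.2 (mem_Ioi.1 hy)]
    · have := h.1.continuousAt (Ioo_mem_nhds hx0 hx.2)
      exact (this.congr (evpos x ⟨hx0, hx.2⟩).symm).continuousWithinAt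
  | succ n ih =>
    obtain ⟨h1, p, hp, h2⟩ := h
    have hder : ∀ x ∈ Ico 0 a, HasDerivWithinAt (fun x => if x ≤ 0 then 0 else u x)
        (if x ≤ 0 then 0 else p x) (Ico 0 a) x := by
      intro x hx
      rcases hx.1.eq_or_lt with rfl | hx0
      · rw [hasDerivWithinAt_iff_tendsto_slope, Ico_sdiff_left]
        · rw [nhdsWithin_Ioo_eq_nhdsGT ha]
          simp only [le_refl, if_true]
          have h1 := key 1 (by push_cast at hr ⊢; omega)
          refine h1.congr' ?_
          filter_upwards [self_mem_nhdsWithin] with y hy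
          simp [slope_def_field, not_le.2 (mem_Ioi.1 hy)]
      · have := (hp x ⟨hx0, hx.2⟩).congr_of_eventuallyEq (evpos x ⟨hx0, hx.2⟩)
        simpa [not_le.2 hx0] using this.hasDerivWithinAt
    push_cast
    rw [contDiffOn_succ_iff_derivWithin (uniq ha)]
    refine ⟨fun x hx => (hder x hx).differentiableWithinAt, by simp, ?_⟩
    have hr' : (n : ℤ) ≤ r - 1 := by push_cast at hr; omega
    refine (ih h2 hr' ?_ ?_).congr fun x hx => (hder x hx).derivWithin (uniq ha x hx)
    · intro k hk
      obtain ⟨m, hm⟩ : ∃ m : ℕ, r - 1 = k + m := ⟨(r - 1 - k).toNat, by omega⟩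
      have h0 : Tendsto (fun x : ℝ => x ^ m) (𝓝[>] 0) (𝓝 (0 ^ m)) :=
        ((continuous_pow m).tendsto 0).mono_left nhdsWithin_le_nhds
      have := h2.little.mul h0
      rw [zero_mul] at this
      refine this.congr' ?_
      filter_upwards [self_mem_nhdsWithin] with x hx
      have hx : x ≠ 0 := ne_of_gt hx
      rw [hm, zpow_add₀ hx, zpow_natCast, zpow_natCast]
      field_simp
    · intro x hx
      filter_upwards [lt_mem_nhds hx.1] with y hy
      simp [not_le.2 hy]

theorem taylor_lim {a : ℝ} (ha : 0 < a) {n : ℕ} {u : ℝ → ℝ} (hu : ContDiffOn ℝ n u (Ico 0 a)) :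
    Tendsto (fun x => (u x - taylorWithinEval u n (Ico 0 a) 0 x) / x ^ n) (𝓝[>] 0) (𝓝 0) := by
  have := (taylor_tendsto (convex_Ico 0 a) (left_mem_Ico.2 ha) hu).mono_left (nhds_le ha)
  refine this.congr fun x => ?_
  simp [div_eq_inv_mul]

theorem taylor_zero {a : ℝ} {n : ℕ} {u : ℝ → ℝ}
    (h : ∀ j ≤ n, iteratedDerivWithin j u (Ico 0 a) 0 = 0) (x : ℝ) :
    taylorWithinEval u n (Ico 0 a) 0 x = 0 := by
  rw [taylor_within_apply]
  refine Finset.sum_eq_zero fun k hk => ?_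
  rw [h k (by have := Finset.mem_range.1 hk; omega), smul_zero]

theorem vanish {a : ℝ} (ha : 0 < a) {n : ℕ} {u : ℝ → ℝ} (hu : ContDiffOn ℝ n u (Ico 0 a))
    (ho : Tendsto (fun x => u x / x ^ n) (𝓝[>] 0) (𝓝 0)) :
    ∀ j ≤ n, iteratedDerivWithin j u (Ico 0 a) 0 = 0 := by
  induction n with
  | zero =>
    intro j hj
    obtain rfl : j = 0 := by omega
    rw [iteratedDerivWithin_zero]
    have h1 := (hu.continuousOn 0 (left_mem_Ico.2 ha)).mono_left (nhds_le ha)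
    exact tendsto_nhds_unique h1 (by simpa using ho)
  | succ n ih =>
    have hz := ih (hu.of_le (by exact_mod_cast Nat.le_succ n)) (by
      have h0 : Tendsto (fun x : ℝ => x) (𝓝[>] 0) (𝓝 0) := nhdsWithin_le_nhds
      have := ho.mul h0
      rw [zero_mul] at this
      refine this.congr' ?_
      filter_upwards [self_mem_nhdsWithin] with x hx
      have hx : x ≠ 0 := ne_of_gt hx
      rw [pow_succ]
      field_simp)
    intro j hj
    rcases Nat.lt_or_ge j (n + 1) with hj' | hj'
    · exact hz j (by omega)
    obtain rfl : j = n + 1 := by omega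
    have h1 := ho.sub (taylor_lim ha hu)
    have h2 : Tendsto (fun _ : ℝ => ((n + 1 : ℝ) * n.factorial)⁻¹ *
        iteratedDerivWithin (n + 1) u (Ico 0 a) 0) (𝓝[>] 0) (𝓝 (0 - 0)) := by
      refine h1.congr' ?_
      filter_upwards [self_mem_nhdsWithin] with x hx
      have hx : x ≠ 0 := ne_of_gt hx
      rw [taylorWithinEval_succ, taylor_zero hz, smul_eq_mul, sub_zero, zero_add, ← sub_div,
        sub_sub_cancel]
      field_simp
    have h3 := tendsto_nhds_unique tendsto_const_nhds h2
    rw [sub_zero] at h3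
    have : ((n + 1 : ℝ) * n.factorial)⁻¹ ≠ 0 := by positivity
    exact (mul_eq_zero.1 h3).resolve_left this

theorem toDD {a : ℝ} (ha : 0 < a) {n : ℕ} {u : ℝ → ℝ} (hu : ContDiffOn ℝ n u (Ico 0 a))
    (hz : ∀ j ≤ n, iteratedDerivWithin j u (Ico 0 a) 0 = 0) : DD a n n u := by
  have hl : Tendsto (fun x => u x / x ^ (n : ℤ)) (𝓝[>] 0) (𝓝 0) := by
    simpa [taylor_zero hz] using taylor_lim ha hu
  induction n generalizing u with
  | zero => exact ⟨hu.continuousOn.mono Ioo_subset_Ico_self, hl⟩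
  | succ n ih =>
    have hu' := hu
    push_cast at hu'
    rw [contDiffOn_succ_iff_derivWithin (uniq ha)] at hu'
    have hz' : ∀ j ≤ n, iteratedDerivWithin j (derivWithin u (Ico 0 a)) (Ico 0 a) 0 = 0 := by
      intro j hj
      rw [← iteratedDerivWithin_succ']
      exact hz _ (by omega)
    refine ⟨hl, derivWithin u (Ico 0 a), fun x hx => ?_, ?_⟩
    · exact (hu'.1 x (Ioo_subset_Ico_self hx)).hasDerivWithinAt.hasDerivAt
        (Ico_mem_nhds hx.1 hx.2)
    · rw [show ((n + 1 : ℕ) : ℤ) - 1 = n by push_cast; ring]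
      refine ih hu'.2.2 hz' ?_
      simpa [taylor_zero hz'] using taylor_lim ha hu'.2.2

/-- Corollary on products.
Let `l ≥ 1` and `f, g : [0,a) → ℝ` be `C^l` with `f x = o(x^l)` and
`g x = o(x^l)` as `x → 0⁺`.  Then `h x := f x * g x / x` extends to a `C^l`
function on `[0,a)`. -/
theorem stmt5 (l : ℕ) (hl : 1 ≤ l) (a : ℝ) (ha : 0 < a) (f g : ℝ → ℝ)
    (hf : ContDiffOn ℝ l f (Set.Ico 0 a)) (hg : ContDiffOn ℝ l g (Set.Ico 0 a))
    (hfo : Filter.Tendsto (fun x => f x / x ^ l) (nhdsWithin 0 (Set.Ioi 0)) (nhds 0))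
    (hgo : Filter.Tendsto (fun x => g x / x ^ l) (nhdsWithin 0 (Set.Ioi 0)) (nhds 0)) :
    ∃ H : ℝ → ℝ, ContDiffOn ℝ l H (Set.Ico 0 a) ∧
      ∀ x ∈ Set.Ioo 0 a, H x = f x * g x / x := by
  have Hf := toDD ha hf (vanish ha hf hfo)
  have Hg := toDD ha hg (vanish ha hg hgo)
  refine ⟨_, (Hf.mul Hg).divx.extend ha (by omega), fun x hx => ?_⟩
  simp [not_le.2 hx.1]
end

section
/- Let n ≥ 2 and let A : D → ℝ be a function of the form A(ρ,z) = ρ² Σ_{k=0}^{⌊(n−1)/2⌋} ρ^{2k} P_k(z) + Φ(ρ,z), where each P_k is a C^{n+1} function of z and Φ is C^{n+1} on D with Φ(ρ,z) = o(ρ^{n+1}) as ρ → 0⁺ (for each z). Then: (1) the function Ã(ρ,z) := A(ρ,z)/ρ (for ρ > 0) extends to D and satisfies Ã(ρ,z) = ρ Σ_{k=0}^{⌊(n−1)/2⌋} ρ^{2k} P_k(z) + Φ̃(ρ,z), where Φ̃ is C^n in ρ and o(ρ^n) as ρ → 0⁺, and is C^{n+1} with respect to z; (2) if Ã and Ã'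 are two functions of this form (with C^{n+1} coefficient functions P_k, P'_k and remainders Φ̃, Φ̃' as in (1)), then (1/ρ)·Ã(ρ,z)·Ã'(ρ,z) = ρ Σ_{k=0}^{⌊(n−1)/2⌋} ρ^{2k} Q_k(z) + Ψ(ρ,z), where each Q_k is a C^{n+1} function of z and Ψ is C^n in ρ and o(ρ^n) as ρ → 0⁺, and C^{n+1} with respect to z. -/
open Set Filter

/-- Functions on `[0,a)` of class `C^m` whose derivatives up to order `m` vanish at `0`. -/
def EE (a : ℝ) : ℕ → (ℝ → ℝ) → Prop
  | 0, f => f 0 = 0 ∧ ContinuousOn f (Ico 0 a)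
  | m + 1, f => f 0 = 0 ∧ ∃ f' : ℝ → ℝ,
      (∀ x ∈ Ico 0 a, HasDerivWithinAt f (f' x) (Ico 0 a) x) ∧ EE a m f'

theorem EE.zero {a : ℝ} {m : ℕ} {f : ℝ → ℝ} (h : EE a m f) : f 0 = 0 := by
  cases m with
  | zero => exact h.1
  | succ m => exact h.1

theorem EE.cont {a : ℝ} {m : ℕ} {f : ℝ → ℝ} (h : EE a m f) : ContinuousOn f (Ico 0 a) := by
  cases m with
  | zero => exact h.2
  | succ m =>
    obtain ⟨_, f', h1, _⟩ := h
    exact fun x hx => (h1 x hx).continuousWithinAt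

theorem EE.mono {a : ℝ} {m : ℕ} : ∀ {f : ℝ → ℝ}, EE a (m + 1) f → EE a m f := by
  induction m with
  | zero => intro f h; exact ⟨h.zero, h.cont⟩
  | succ m ih =>
    intro f h
    obtain ⟨h0, f', h1, h2⟩ := h
    exact ⟨h0, f', h1, ih h2⟩

theorem EE.mono_le {a : ℝ} {m k : ℕ} {f : ℝ → ℝ} (h : EE a (m + k) f) : EE a m f := by
  induction k with
  | zero => exact h
  | succ k ih => exact ih (EE.mono h)

theorem EE.sub_mul {a : ℝ} {m : ℕ} (c : ℝ) : ∀ {f g : ℝ → ℝ}, EE a m f → EE a m g →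
    EE a m (fun x => f x - c * g x) := by
  induction m with
  | zero =>
    intro f g hf hg
    exact ⟨by simp [hf.zero, hg.zero], hf.cont.sub (continuousOn_const.mul hg.cont)⟩
  | succ m ih =>
    intro f g hf hg
    obtain ⟨h0, f', h1, h2⟩ := hf
    obtain ⟨k0, g', k1, k2⟩ := hg
    exact ⟨by simp [h0, k0], fun x => f' x - c * g' x,
      fun x hx => (h1 x hx).sub ((k1 x hx).const_mul c), ih h2 k2⟩

theorem EE.small {a : ℝ} {m : ℕ} (ha : 0 < a) : ∀ {f : ℝ → ℝ}, EE a m f → ∀ ε > 0,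
    ∃ δ > 0, ∀ x ∈ Ico 0 a, x < δ → |f x| ≤ ε * x ^ m := by
  induction m with
  | zero =>
    intro f hf ε hε
    have := hf.cont 0 ⟨le_rfl, ha⟩
    rw [Metric.continuousWithinAt_iff] at this
    obtain ⟨δ, hδ, h⟩ := this ε hε
    refine ⟨δ, hδ, fun x hx hxd => ?_⟩
    have := h hx (by rw [Real.dist_eq, sub_zero, abs_of_nonneg hx.1]; exact hxd)
    rw [Real.dist_eq, hf.zero, sub_zero] at this
    simpa using this.le
  | succ m ih =>
    intro f hf ε hε
    obtain ⟨h0, f', h1, h2⟩ := hf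
    obtain ⟨δ, hδ, h⟩ := ih h2 ε hε
    refine ⟨δ, hδ, fun x hx hxd => ?_⟩
    have hsub : Icc 0 x ⊆ Ico 0 a := fun y hy => ⟨hy.1, hy.2.trans_lt hx.2⟩
    have := Convex.norm_image_sub_le_of_norm_hasDerivWithin_le (f := f) (f' := f')
      (s := Icc 0 x) (C := ε * x ^ m) (x := 0) (y := x)
      (fun y hy => (h1 y (hsub hy)).mono hsub)
      (fun y hy => by
        rw [Real.norm_eq_abs]
        refine (h y (hsub hy) (hy.2.trans_lt hxd)).trans ?_
        have := pow_le_pow_left₀ hy.1 hy.2 m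
        gcongr)
      (convex_Icc _ _) ⟨le_rfl, hx.1⟩ ⟨hx.1, le_rfl⟩
    rw [h0, sub_zero, sub_zero, Real.norm_eq_abs, Real.norm_eq_abs, abs_of_nonneg hx.1] at this
    rw [pow_succ, ← mul_assoc]; exact this

theorem EE.tendsto {a : ℝ} {m : ℕ} (ha : 0 < a) {f : ℝ → ℝ} (hf : EE a m f) :
    Tendsto (fun x => f x / x ^ m) (nhdsWithin 0 (Ioi 0)) (nhds 0) := by
  rw [Metric.tendsto_nhdsWithin_nhds]
  intro ε hε
  obtain ⟨δ, hδ, h⟩ := hf.small ha (ε / 2) (by positivity)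
  refine ⟨min δ a, lt_min hδ ha, fun x hx hxd => ?_⟩
  have hx0 : 0 < x := hx
  rw [Real.dist_eq, sub_zero, abs_of_pos hx0, lt_min_iff] at hxd
  have := h x ⟨hx0.le, hxd.2⟩ hxd.1
  rw [Real.dist_eq, sub_zero, abs_div, abs_of_pos (pow_pos hx0 m), div_lt_iff₀ (pow_pos hx0 m)]
  refine this.trans_lt ?_
  have := pow_pos hx0 m
  nlinarith

theorem EE.contDiffOn {a : ℝ} {m : ℕ} (ha : 0 < a) : ∀ {f : ℝ → ℝ}, EE a m f →
    ContDiffOn ℝ m f (Ico 0 a) := by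
  induction m with
  | zero => intro f hf; exact_mod_cast contDiffOn_zero.2 hf.cont
  | succ m ih =>
    intro f hf
    obtain ⟨h0, f', h1, h2⟩ := hf
    push_cast
    rw [contDiffOn_succ_iff_derivWithin (uniqueDiffOn_Ico 0 a)]
    refine ⟨fun x hx => (h1 x hx).differentiableWithinAt, by simp, ?_⟩
    exact (ih h2).congr fun x hx => (h1 x hx).derivWithin (uniqueDiffOn_Ico 0 a x hx)

theorem EE.step {a : ℝ} {m : ℕ} (ha : 0 < a) : ∀ {f : ℝ → ℝ}, EE a m f →
    ContDiffOn ℝ (m + 1 : ℕ) f (Ico 0 a) →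
    ∃ c : ℝ, EE a (m + 1) (fun x => f x - c * x ^ (m + 1)) := by
  induction m with
  | zero =>
    intro f hf hc
    rw [Nat.cast_succ, contDiffOn_succ_iff_derivWithin (uniqueDiffOn_Ico 0 a)] at hc
    obtain ⟨h1, -, h2⟩ := hc
    refine ⟨derivWithin f (Ico 0 a) 0, by simp [hf.zero],
      fun x => derivWithin f (Ico 0 a) x - derivWithin f (Ico 0 a) 0, fun x hx => ?_, by simp,
      h2.continuousOn.sub continuousOn_const⟩
    have := (h1 x hx).hasDerivWithinAt.sub
      ((hasDerivWithinAt_id x (Ico 0 a)).const_mul (derivWithin f (Ico 0 a) 0))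
    simp only [zero_add, pow_one]
    exact HasDerivWithinAt.congr_deriv this (by simp)
  | succ m ih =>
    intro f hf hc
    obtain ⟨h0, f', h1, h2⟩ := hf
    rw [Nat.cast_succ, contDiffOn_succ_iff_derivWithin (uniqueDiffOn_Ico 0 a)] at hc
    obtain ⟨-, -, h3⟩ := hc
    obtain ⟨c, hc⟩ := ih h2 (h3.congr fun x hx =>
      ((h1 x hx).derivWithin (uniqueDiffOn_Ico 0 a x hx)).symm)
    refine ⟨c / (m + 2), by simp [h0], _, fun x hx => ?_, hc⟩
    have := (h1 x hx).sub
      (((hasDerivAt_pow (m + 1 + 1) x).hasDerivWithinAt (s := Ico 0 a)).const_mul (c / (m + 2)))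
    refine HasDerivWithinAt.congr_deriv this ?_
    have : (m : ℝ) + 2 ≠ 0 := by positivity
    rw [Nat.add_sub_cancel]
    push_cast
    field_simp
    ring

theorem EE.of_contDiffOn {a : ℝ} {m : ℕ} (ha : 0 < a) {f : ℝ → ℝ}
    (hf : ContDiffOn ℝ m f (Ico 0 a))
    (ho : Tendsto (fun x => f x / x ^ m) (nhdsWithin 0 (Ioi 0)) (nhds 0)) : EE a m f := by
  have hid : Tendsto (fun x : ℝ => x) (nhdsWithin 0 (Ioi 0)) (nhds 0) := nhdsWithin_le_nhds
  induction m with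
  | zero =>
    refine ⟨?_, hf.continuousOn⟩
    have h1 : Tendsto f (nhdsWithin 0 (Ioi 0)) (nhds (f 0)) := by
      have := hf.continuousOn 0 ⟨le_rfl, ha⟩
      refine this.mono_left ?_
      rw [← nhdsWithin_Ioo_eq_nhdsGT ha]
      exact nhdsWithin_mono _ Ioo_subset_Ico_self
    exact tendsto_nhds_unique h1 (by simpa using ho)
  | succ m ih =>
    have h1 : EE a m f := by
      refine ih (hf.of_le (by exact_mod_cast Nat.le_succ m)) ?_
      have := ho.mul hid
      rw [zero_mul] at this
      refine this.congr' ?_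
      filter_upwards [self_mem_nhdsWithin] with x hx
      have : x ≠ 0 := ne_of_gt hx
      field_simp
      ring
    obtain ⟨c, hc⟩ := h1.step ha hf
    have h2 := hc.tendsto ha
    have h3 : Tendsto (fun _ : ℝ => c) (nhdsWithin (0 : ℝ) (Ioi 0)) (nhds 0) := by
      have := ho.sub h2
      rw [sub_zero] at this
      refine this.congr' ?_
      filter_upwards [self_mem_nhdsWithin] with x hx
      have : x ≠ 0 := ne_of_gt hx
      field_simp
      ring
    have : c = 0 := tendsto_nhds_unique tendsto_const_nhds h3
    simpa [this] using hc

/-- a function vanishing to second order at `0` has zero one-sided derivative. -/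
theorem hasDeriv_zero_of_small {a : ℝ} {g : ℝ → ℝ} (h0 : g 0 = 0)
    (h : ∀ ε > 0, ∃ δ > 0, ∀ x ∈ Ico 0 a, x < δ → |g x| ≤ ε * x) :
    HasDerivWithinAt g 0 (Ico 0 a) 0 := by
  rw [hasDerivWithinAt_iff_isLittleO, Asymptotics.isLittleO_iff]
  intro ε hε
  obtain ⟨δ, hδ, hh⟩ := h ε hε
  filter_upwards [self_mem_nhdsWithin, nhdsWithin_le_nhds (Iio_mem_nhds hδ)] with x hx hxd
  have := hh x hx hxd
  simpa [h0, abs_of_nonneg hx.1] using this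

theorem EE.div {a : ℝ} {q : ℕ} (ha : 0 < a) : ∀ {p : ℕ} {f : ℝ → ℝ}, EE a (p + q) f →
    EE a q (fun x => f x / x ^ p) := by
  induction q with
  | zero =>
    intro p f hf
    refine ⟨by simp [hf.zero], fun x hx => ?_⟩
    rcases hx.1.eq_or_lt with rfl | hx0
    · rw [Metric.continuousWithinAt_iff]
      intro ε hε
      obtain ⟨δ, hδ, h⟩ := hf.small ha (ε / 2) (by positivity)
      refine ⟨δ, hδ, fun y hy hyd => ?_⟩
      rw [Real.dist_eq, sub_zero, abs_of_nonneg hy.1] at hyd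
      have := h y hy hyd
      rw [Real.dist_eq, hf.zero, zero_div, sub_zero, abs_div]
      rcases hy.1.eq_or_lt with rfl | hy0
      · simpa [hf.zero] using hε
      · rw [abs_of_pos (pow_pos hy0 p), div_lt_iff₀ (pow_pos hy0 p)]
        refine this.trans_lt ?_
        have := pow_pos hy0 p
        simp only [add_zero]
        nlinarith
    · exact (hf.cont x hx).div (continuous_pow p).continuousWithinAt (pow_pos hx0 p).ne'
  | succ q ih =>
    intro p f hf
    have hf1 : EE a (p + 1 + q) f := by rwa [show p + 1 + q = p + (q + 1) by ring]
    obtain ⟨h0, f', h1, h2⟩ := (hf : EE a ((p + q) + 1) f)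
    refine ⟨by simp [h0], fun x => f' x / x ^ p - p * (f x / x ^ (p + 1)), fun x hx => ?_,
      (ih h2).sub_mul (p : ℝ) (ih hf1)⟩
    rcases hx.1.eq_or_lt with rfl | hx0
    · simp only [h0, h2.zero, zero_div, mul_zero, sub_zero]
      refine hasDeriv_zero_of_small (by simp [h0]) fun ε hε => ?_
      obtain ⟨δ, hδ, h⟩ := hf1.mono_le.small ha ε hε
      refine ⟨δ, hδ, fun y hy hyd => ?_⟩
      have := h y hy hyd
      rcases hy.1.eq_or_lt with rfl | hy0
      · simp [h0]
      · rw [abs_div, abs_of_pos (pow_pos hy0 p), div_le_iff₀ (pow_pos hy0 p)]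
        refine this.trans (le_of_eq (by ring))
    · have := (h1 x hx).div ((hasDerivAt_pow p x).hasDerivWithinAt (s := Ico 0 a))
        (pow_pos hx0 p).ne'
      refine HasDerivWithinAt.congr_deriv this ?_
      rcases p with _ | p
      · simp
      · rw [Nat.add_sub_cancel]
        field_simp
        try ring

theorem EE.prod_div {a : ℝ} {m : ℕ} (ha : 0 < a) {f g : ℝ → ℝ} (hf : EE a (m + 1) f)
    (hg : EE a (m + 1) g) (hm : 1 ≤ m) :
    ContDiffOn ℝ (m + 1 : ℕ) (fun x => f x * g x / x) (Ico 0 a) := by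
  have hfd : ContDiffOn ℝ m (fun x => f x / x ^ 1) (Ico 0 a) :=
    (EE.div (p := 1) ha (by rwa [add_comm])).contDiffOn ha
  have hgd : ContDiffOn ℝ m (fun x => g x / x ^ 1) (Ico 0 a) :=
    (EE.div (p := 1) ha (by rwa [add_comm])).contDiffOn ha
  have hf1 : EE a 1 f := EE.mono_le (k := m) (by rwa [add_comm])
  have hg1 : EE a 1 g := EE.mono_le (k := m) (by rwa [add_comm])
  obtain ⟨f0, f', f1, f2⟩ := hf
  obtain ⟨g0, g', g1, g2⟩ := hg
  have key : ∀ x ∈ Ico 0 a, HasDerivWithinAt (fun x => f x * g x / x)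
      (f' x * (g x / x ^ 1) + f x / x ^ 1 * g' x - f x / x ^ 1 * (g x / x ^ 1)) (Ico 0 a) x := by
    intro x hx
    rcases hx.1.eq_or_lt with rfl | hx0
    · simp only [f0, g0, zero_div, mul_zero, zero_mul, add_zero, sub_zero]
      refine hasDeriv_zero_of_small (by simp) fun ε hε => ?_
      obtain ⟨δ, hδ, h⟩ := hf1.small ha ε hε
      obtain ⟨δ', hδ', h'⟩ := hg1.small ha 1 one_pos
      refine ⟨min δ δ', lt_min hδ hδ', fun y hy hyd => ?_⟩
      rw [lt_min_iff] at hyd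
      have e1 := h y hy hyd.1
      have e2 := h' y hy hyd.2
      rcases hy.1.eq_or_lt with rfl | hy0
      · simp
      · rw [abs_div, abs_of_pos hy0, div_le_iff₀ hy0, abs_mul]
        rw [pow_one] at e1 e2
        have := mul_le_mul e1 e2 (abs_nonneg _) (by positivity)
        linarith
    · have := ((f1 x hx).mul (g1 x hx)).div (hasDerivWithinAt_id x (Ico 0 a)) hx0.ne'
      refine HasDerivWithinAt.congr_deriv this ?_
      simp only [id, Pi.mul_apply]
      field_simp
  rw [Nat.cast_succ, contDiffOn_succ_iff_derivWithin (uniqueDiffOn_Ico 0 a)]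
  refine ⟨fun x hx => (key x hx).differentiableWithinAt, by simp, ?_⟩
  refine ContDiffOn.congr ?_ fun x hx => (key x hx).derivWithin (uniqueDiffOn_Ico 0 a x hx)
  exact (((f2.contDiffOn ha).mul hgd).add (hfd.mul (g2.contDiffOn ha))).sub (hfd.mul hgd)

/- **Statement 19** (Claim in the proof of Proposition `Block`).
Let `n ≥ 2` and `A(ρ,z) = ρ² Σ_{k=0}^{⌊(n−1)/2⌋} ρ^{2k} P_k(z) + Φ(ρ,z)` on
`D = [0,a) × Z`, with `P_k` of class `C^{n+1}` and `Φ` of class `C^{n+1}` on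
`D` with `Φ = o(ρ^{n+1})` as `ρ → 0⁺`.  Then:
(1) `Ã(ρ,z) := A(ρ,z)/ρ` extends to `D` and satisfies
`Ã = ρ Σ ρ^{2k} P_k(z) + Φ̃` with `Φ̃` being `C^n` in `ρ`, `o(ρ^n)` as
`ρ → 0⁺`, and `C^{n+1}` in `z`;
(2) if `Ã, Ã'` are two functions of this form, then
`(1/ρ)·Ã·Ã' = ρ Σ ρ^{2k} Q_k(z) + Ψ` with `Q_k` of class `C^{n+1}` and `Ψ`
being `C^n` in `ρ`, `o(ρ^n)` and `C^{n+1}` in `z`. -/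
theorem stmt19 (n : ℕ) (hn : 2 ≤ n) (a : ℝ) (ha : 0 < a) (z₀ z₁ : ℝ) (hz : z₀ < z₁)
    (A : ℝ × ℝ → ℝ) (P : ℕ → ℝ → ℝ) (Φ : ℝ × ℝ → ℝ)
    (hP : ∀ k, ContDiff ℝ (n + 1) (P k))
    (hΦ : ContDiffOn ℝ (n + 1) Φ (Set.Ico 0 a ×ˢ Set.Ioo z₀ z₁))
    (hΦo : ∀ z ∈ Set.Ioo z₀ z₁,
      Tendsto (fun ρ => Φ (ρ, z) / ρ ^ (n + 1)) (nhdsWithin 0 (Set.Ioi 0)) (nhds 0))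
    (hA : ∀ pt ∈ Set.Ico 0 a ×ˢ Set.Ioo z₀ z₁,
      A pt = pt.1 ^ 2 *
          (∑ k ∈ Finset.range ((n - 1) / 2 + 1), pt.1 ^ (2 * k) * P k pt.2) +
        Φ pt) :
    (∃ Φt : ℝ × ℝ → ℝ,
      (∀ pt ∈ Set.Ico 0 a ×ˢ Set.Ioo z₀ z₁, 0 < pt.1 →
        A pt / pt.1 =
          pt.1 * (∑ k ∈ Finset.range ((n - 1) / 2 + 1), pt.1 ^ (2 * k) * P k pt.2)
            + Φt pt) ∧
      (∀ z ∈ Set.Ioo z₀ z₁, ContDiffOn ℝ n (fun ρ => Φt (ρ, z)) (Set.Ico 0 a)) ∧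
      (∀ z ∈ Set.Ioo z₀ z₁,
        Tendsto (fun ρ => Φt (ρ, z) / ρ ^ n) (nhdsWithin 0 (Set.Ioi 0)) (nhds 0)) ∧
      (∀ ρ ∈ Set.Ico 0 a,
        ContDiffOn ℝ (n + 1) (fun z => Φt (ρ, z)) (Set.Ioo z₀ z₁))) ∧
    (∀ (P' P'' : ℕ → ℝ → ℝ) (Φ' Φ'' : ℝ × ℝ → ℝ),
      (∀ k, ContDiff ℝ (n + 1) (P' k)) →
      (∀ k, ContDiff ℝ (n + 1) (P'' k)) →
      (∀ z ∈ Set.Ioo z₀ z₁, ContDiffOn ℝ n (fun ρ => Φ' (ρ, z)) (Set.Ico 0 a)) →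
      (∀ z ∈ Set.Ioo z₀ z₁,
        Tendsto (fun ρ => Φ' (ρ, z) / ρ ^ n) (nhdsWithin 0 (Set.Ioi 0)) (nhds 0)) →
      (∀ ρ ∈ Set.Ico 0 a,
        ContDiffOn ℝ (n + 1) (fun z => Φ' (ρ, z)) (Set.Ioo z₀ z₁)) →
      (∀ z ∈ Set.Ioo z₀ z₁, ContDiffOn ℝ n (fun ρ => Φ'' (ρ, z)) (Set.Ico 0 a)) →
      (∀ z ∈ Set.Ioo z₀ z₁,
        Tendsto (fun ρ => Φ'' (ρ, z) / ρ ^ n) (nhdsWithin 0 (Set.Ioi 0)) (nhds 0)) →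
      (∀ ρ ∈ Set.Ico 0 a,
        ContDiffOn ℝ (n + 1) (fun z => Φ'' (ρ, z)) (Set.Ioo z₀ z₁)) →
      ∃ (Q : ℕ → ℝ → ℝ) (Ψ : ℝ × ℝ → ℝ),
        (∀ k, ContDiff ℝ (n + 1) (Q k)) ∧
        (∀ pt ∈ Set.Ico 0 a ×ˢ Set.Ioo z₀ z₁, 0 < pt.1 →
          (pt.1 * (∑ k ∈ Finset.range ((n - 1) / 2 + 1),
              pt.1 ^ (2 * k) * P' k pt.2) + Φ' pt) *
            (pt.1 * (∑ k ∈ Finset.range ((n - 1) / 2 + 1),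
              pt.1 ^ (2 * k) * P'' k pt.2) + Φ'' pt) / pt.1 =
          pt.1 * (∑ k ∈ Finset.range ((n - 1) / 2 + 1),
              pt.1 ^ (2 * k) * Q k pt.2) + Ψ pt) ∧
        (∀ z ∈ Set.Ioo z₀ z₁, ContDiffOn ℝ n (fun ρ => Ψ (ρ, z)) (Set.Ico 0 a)) ∧
        (∀ z ∈ Set.Ioo z₀ z₁,
          Tendsto (fun ρ => Ψ (ρ, z) / ρ ^ n) (nhdsWithin 0 (Set.Ioi 0)) (nhds 0)) ∧
        (∀ ρ ∈ Set.Ico 0 a,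
          ContDiffOn ℝ (n + 1) (fun z => Ψ (ρ, z)) (Set.Ioo z₀ z₁))) := by
  have hid : Tendsto (fun x : ℝ => x) (nhdsWithin 0 (Ioi 0)) (nhds 0) := nhdsWithin_le_nhds
  refine ⟨⟨fun pt => Φ pt / pt.1, ?_, ?_, ?_, ?_⟩, ?_⟩
  · intro pt hpt h0
    rw [hA pt hpt]
    field_simp
  · intro z hz'
    have h1 : ContDiffOn ℝ (n + 1 : ℕ) (fun ρ => Φ (ρ, z)) (Set.Ico 0 a) := by
      have : ContDiffOn ℝ (n + 1 : ℕ) (fun ρ : ℝ => (ρ, z)) (Set.Ico 0 a) := by fun_prop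
      have hΦ' : ContDiffOn ℝ (n + 1 : ℕ) Φ (Set.Ico 0 a ×ˢ Set.Ioo z₀ z₁) := by
        exact_mod_cast hΦ
      exact hΦ'.comp this fun x hx => ⟨hx, hz'⟩
    have h2 := EE.of_contDiffOn ha h1 (hΦo z hz')
    have h3 := (EE.div (p := 1) (q := n) ha (by rwa [add_comm])).contDiffOn ha
    simpa using h3
  · intro z hz'
    refine (hΦo z hz').congr' ?_
    filter_upwards [self_mem_nhdsWithin] with x hx
    have : x ≠ 0 := ne_of_gt hx
    field_simp
    ring
  · intro ρ hρ
    have h1 : ContDiffOn ℝ (n + 1) (fun z => Φ (ρ, z)) (Set.Ioo z₀ z₁) := by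
      have : ContDiffOn ℝ (n + 1) (fun z : ℝ => (ρ, z)) (Set.Ioo z₀ z₁) := by fun_prop
      exact hΦ.comp this fun x hx => ⟨hρ, hx⟩
    exact h1.div_const ρ
  · intro P' P'' Φ' Φ'' hP' hP'' c' o' d' c'' o'' d''
    set N := (n - 1) / 2 with hN
    have hE' : ∀ z ∈ Set.Ioo z₀ z₁, EE a n (fun ρ => Φ' (ρ, z)) := fun z hz' =>
      EE.of_contDiffOn ha (c' z hz') (o' z hz')
    have hE'' : ∀ z ∈ Set.Ioo z₀ z₁, EE a n (fun ρ => Φ'' (ρ, z)) := fun z hz' =>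
      EE.of_contDiffOn ha (c'' z hz') (o'' z hz')
    let R : ℝ × ℝ → ℝ := fun pt => ∑ i ∈ Finset.range (N + 1), ∑ j ∈ Finset.range (N + 1),
      if i + j < N + 1 then 0 else pt.1 ^ (2 * (i + j) - n) * (P' i pt.2 * P'' j pt.2)
    let S' : ℝ × ℝ → ℝ := fun pt => ∑ k ∈ Finset.range (N + 1), pt.1 ^ (2 * k) * P' k pt.2
    let S'' : ℝ × ℝ → ℝ := fun pt => ∑ k ∈ Finset.range (N + 1), pt.1 ^ (2 * k) * P'' k pt.2
    have cR : ∀ z, ContDiff ℝ n (fun ρ => R (ρ, z)) := by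
      intro z
      refine ContDiff.sum fun i _ => ContDiff.sum fun j _ => ?_
      dsimp only
      split_ifs <;> fun_prop
    have cS' : ∀ z, ContDiff ℝ n (fun ρ => S' (ρ, z)) := by
      intro z
      refine ContDiff.sum fun i _ => ?_
      dsimp only
      fun_prop
    have cS'' : ∀ z, ContDiff ℝ n (fun ρ => S'' (ρ, z)) := by
      intro z
      refine ContDiff.sum fun i _ => ?_
      dsimp only
      fun_prop
    have dR : ∀ ρ, ContDiff ℝ (n + 1) (fun z => R (ρ, z)) := by
      intro z
      refine ContDiff.sum fun i _ => ContDiff.sum fun j _ => ?_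
      split_ifs
      · fun_prop
      · exact (contDiff_const (c := z ^ (2 * (i + j) - n))).mul ((hP' i).mul (hP'' j))
    have dS' : ∀ ρ, ContDiff ℝ (n + 1) (fun z => S' (ρ, z)) := by
      intro z
      exact ContDiff.sum fun i _ => (contDiff_const (c := z ^ (2 * i))).mul (hP' i)
    have dS'' : ∀ ρ, ContDiff ℝ (n + 1) (fun z => S'' (ρ, z)) := by
      intro z
      exact ContDiff.sum fun i _ => (contDiff_const (c := z ^ (2 * i))).mul (hP'' i)
    refine ⟨fun k z => ∑ i ∈ Finset.range (N + 1), ∑ j ∈ Finset.range (N + 1),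
        if i + j = k then P' i z * P'' j z else 0,
      fun pt => S' pt * Φ'' pt + S'' pt * Φ' pt + Φ' pt * Φ'' pt / pt.1 + pt.1 ^ (n + 1) * R pt,
      ?_, ?_, ?_, ?_, ?_⟩
    · intro k
      refine ContDiff.sum fun i _ => ContDiff.sum fun j _ => ?_
      split_ifs
      · exact (hP' i).mul (hP'' j)
      · exact contDiff_const
    · intro pt hpt h0
      have key : pt.1 * (S' pt * S'' pt) = pt.1 * (∑ k ∈ Finset.range (N + 1), pt.1 ^ (2 * k) *
          ∑ i ∈ Finset.range (N + 1), ∑ j ∈ Finset.range (N + 1),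
            if i + j = k then P' i pt.2 * P'' j pt.2 else 0) + pt.1 ^ (n + 1) * R pt := by
        have e1 : (∑ k ∈ Finset.range (N + 1), pt.1 ^ (2 * k) *
          ∑ i ∈ Finset.range (N + 1), ∑ j ∈ Finset.range (N + 1),
            if i + j = k then P' i pt.2 * P'' j pt.2 else 0) =
          ∑ i ∈ Finset.range (N + 1), ∑ j ∈ Finset.range (N + 1),
            if i + j < N + 1 then pt.1 ^ (2 * (i + j)) * (P' i pt.2 * P'' j pt.2) else 0 := by
          simp only [Finset.mul_sum]
          rw [Finset.sum_comm]
          refine Finset.sum_congr rfl fun i _ => ?_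
          rw [Finset.sum_comm]
          refine Finset.sum_congr rfl fun j _ => ?_
          simp only [mul_ite, mul_zero, Finset.sum_ite_eq, Finset.mem_range]
        rw [e1]
        simp only [S', S'', R]
        rw [Finset.sum_mul_sum]
        simp only [Finset.mul_sum, ← Finset.sum_add_distrib]
        refine Finset.sum_congr rfl fun i _ => Finset.sum_congr rfl fun j _ => ?_
        split_ifs with h
        · ring
        · have : pt.1 * pt.1 ^ (2 * (i + j)) = pt.1 ^ (n + 1) * pt.1 ^ (2 * (i + j) - n) := by
            rw [← pow_succ', ← pow_add]
            congr 1
            omega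
          rw [← mul_assoc (pt.1 ^ (n + 1)), ← this]
          ring
      change (pt.1 * S' pt + Φ' pt) * (pt.1 * S'' pt + Φ'' pt) / pt.1 = _
      have : (pt.1 * S' pt + Φ' pt) * (pt.1 * S'' pt + Φ'' pt) / pt.1 =
        pt.1 * (S' pt * S'' pt) + (S' pt * Φ'' pt + S'' pt * Φ' pt + Φ' pt * Φ'' pt / pt.1) := by
        field_simp
        ring
      rw [this, key]
      ring
    · intro z hz'
      have h1 : ContDiffOn ℝ n (fun ρ => Φ' (ρ, z) * Φ'' (ρ, z) / ρ) (Set.Ico 0 a) := by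
        obtain ⟨m, rfl⟩ : ∃ m, n = m + 1 := ⟨n - 1, by omega⟩
        exact (hE' z hz').prod_div ha (hE'' z hz') (by omega)
      have h2 : ContDiffOn ℝ n (fun ρ : ℝ => ρ ^ (n + 1)) (Set.Ico 0 a) := by fun_prop
      exact ((((cS' z).contDiffOn.mul (c'' z hz')).add ((cS'' z).contDiffOn.mul (c' z hz'))).add
        h1).add (h2.mul (cR z).contDiffOn)
    · intro z hz'
      have t : ∀ {F : ℝ → ℝ}, ContDiff ℝ n F →
          Tendsto F (nhdsWithin 0 (Ioi 0)) (nhds (F 0)) := fun h =>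
        (h.continuous.tendsto 0).mono_left nhdsWithin_le_nhds
      have hE1 : EE a 1 (fun ρ => Φ' (ρ, z)) := by
        obtain ⟨m, rfl⟩ : ∃ m, n = 1 + m := ⟨n - 1, by omega⟩
        exact (hE' z hz').mono_le
      have := ((((t (cS' z)).mul (o'' z hz')).add ((t (cS'' z)).mul (o' z hz'))).add
        ((hE1.tendsto ha).mul (o'' z hz'))).add (hid.mul (t (cR z)))
      simp only [mul_zero, zero_mul, add_zero] at this
      refine this.congr' ?_
      filter_upwards [self_mem_nhdsWithin] with x hx
      have : x ≠ 0 := ne_of_gt hx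
      field_simp
      ring
    · intro ρ hρ
      exact ((((dS' ρ).contDiffOn.mul (d'' ρ hρ)).add ((dS'' ρ).contDiffOn.mul (d' ρ hρ))).add
        (((d' ρ hρ).mul (d'' ρ hρ)).div_const ρ)).add ((contDiffOn_const (c := ρ ^ (n + 1))).mul (dR ρ).contDiffOn)
end
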